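/- arXiv:2011.14248 — 2 statements merged into one kernel-verified Lean document; each statement's English description precedes it below -/
import Mathlib

section
/- Let n ≥ 2 and c ≥ 1 be integers. For nonnegative integers m_{ij} (1 ≤ i < j ≤ n) with 0 ≤ m_{ij} ≤ 2c, set m̄_{ij} = 2c - m_{ij}, r_k = Σ_{i<k} m̄_{ik} + Σ_{k<i} m_{ki}, and s_k = Σ_{i<k} m_{ik} + Σ_{k<i} m̄_{ki}. Then in ℤ[x,y]: Σ over all choices of (m_{ij}) of (-1)^(Σ m_{ij}) ∏_{i<j} C(2c, m_{ij}) · ∏_{k=1}^n (x)_{r_k} (y)_{s_k} = ∏_{k=1}^{n-1} [((k+1)c)!/c!] · (x)_{kc} (y)_{kc} (x+y+(2n-k-2)c)_{kc}, where (x)_m = x(x+1)···(x+m-1) is the rising Pochhammer symbol. -/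
open Finset MvPolynomial

/-- The rising Pochhammer symbol `(x)_m = x(x+1)⋯(x+m-1)`. -/
def risingFactorial {R : Type*} [CommRing R] (x : R) (m : ℕ) : R :=
  ∏ i ∈ Finset.range m, (x + (i : R))

/-- Extend a choice of `m_{ij}` for `i < j` to all pairs (`0` elsewhere). -/
def mVal (n c : ℕ) (m : {q : Fin n × Fin n // q.1 < q.2} → Fin (2 * c + 1))
    (i j : Fin n) : ℕ :=
  if h : i < j then (m ⟨(i, j), h⟩ : ℕ) else 0

/-- `r_k = Σ_{i<k} (2c - m_{ik}) + Σ_{k<i} m_{ki}`. -/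
def rVal (n c : ℕ) (m : {q : Fin n × Fin n // q.1 < q.2} → Fin (2 * c + 1))
    (k : Fin n) : ℕ :=
  (∑ i ∈ Finset.univ.filter (fun i => i < k), (2 * c - mVal n c m i k)) +
    ∑ i ∈ Finset.univ.filter (fun i => k < i), mVal n c m k i

/-- `s_k = Σ_{i<k} m_{ik} + Σ_{k<i} (2c - m_{ki})`. -/
def sVal (n c : ℕ) (m : {q : Fin n × Fin n // q.1 < q.2} → Fin (2 * c + 1))
    (k : Fin n) : ℕ :=
  (∑ i ∈ Finset.univ.filter (fun i => i < k), mVal n c m i k) +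
    ∑ i ∈ Finset.univ.filter (fun i => k < i), (2 * c - mVal n c m k i)

theorem risingFactorial_zero {R : Type*} [CommRing R] (x : R) : risingFactorial x 0 = 1 := by
  simp [risingFactorial]

theorem risingFactorial_succ {R : Type*} [CommRing R] (x : R) (m : ℕ) :
    risingFactorial x (m + 1) = risingFactorial x m * (x + m) := by
  simp [risingFactorial, Finset.prod_range_succ]

theorem risingFactorial_add {R : Type*} [CommRing R] (x : R) (a b : ℕ) :
    risingFactorial x (a + b) = risingFactorial x a * risingFactorial (x + a) b := by
  induction b with
  | zero => simp [risingFactorial_zero]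
  | succ b ih =>
    rw [← add_assoc, risingFactorial_succ, risingFactorial_succ, ih]; push_cast; ring

theorem risingFactorial_shift {R : Type*} [CommRing R] (x : R) (m : ℕ) :
    x * risingFactorial (x + 1) m = risingFactorial x m * (x + m) := by
  rw [← risingFactorial_succ, add_comm m 1, risingFactorial_add]
  simp [risingFactorial]

theorem map_risingFactorial {R S : Type*} [CommRing R] [CommRing S] (f : R →+* S) (x : R)
    (m : ℕ) : f (risingFactorial x m) = risingFactorial (f x) m := by
  simp [risingFactorial, map_prod]

theorem risingFactorial_pos {x : ℚ} (hx : 0 < x) (m : ℕ) : 0 < risingFactorial x m :=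
  Finset.prod_pos fun i _ => by positivity

theorem risingFactorial_one (m : ℕ) : risingFactorial (1 : ℚ) m = m.factorial := by
  induction m with
  | zero => simp [risingFactorial_zero]
  | succ m ih => rw [risingFactorial_succ, ih, Nat.factorial_succ]; push_cast; ring

/-- The moment of order `a` of the beta distribution with parameters `x` and `y`. -/
noncomputable def betaMoment (x y : ℚ) (a : ℕ) : ℚ :=
  risingFactorial x a / risingFactorial (x + y) a

theorem betaMoment_succ {x y : ℚ} (hx : 0 < x) (hy : 0 < y) (a : ℕ) :
    (x + y + a) * betaMoment x y (a + 1) = (x + a) * betaMoment x y a := by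
  have h1 := (risingFactorial_pos (add_pos hx hy) a).ne'
  have h2 : x + y + a ≠ 0 := by positivity
  rw [betaMoment, betaMoment, risingFactorial_succ, risingFactorial_succ]
  field_simp

theorem betaMoment_add {x y : ℚ} (a b : ℕ) :
    betaMoment x y (a + b) = betaMoment x y a * betaMoment (x + a) y b := by
  rw [betaMoment, betaMoment, betaMoment, risingFactorial_add, risingFactorial_add,
    add_right_comm x y, mul_div_mul_comm]

/-- The expectation of a polynomial in independent beta variables with parameters `x`, `y`. -/
noncomputable def betaExp (n : ℕ) (x y : ℚ) : MvPolynomial (Fin n) ℚ →ₗ[ℚ] ℚ :=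
  (MvPolynomial.basisMonomials (Fin n) ℚ).constr ℚ fun a => ∏ k, betaMoment x y (a k)

theorem betaExp_monomial (n : ℕ) (x y : ℚ) (a : Fin n →₀ ℕ) :
    betaExp n x y (monomial a 1) = ∏ k, betaMoment x y (a k) := by
  simpa [betaExp] using (basisMonomials (Fin n) ℚ).constr_basis ℚ (fun a => ∏ k, betaMoment x y (a k)) a

theorem betaExp_rename {n : ℕ} (x y : ℚ) (e : Equiv.Perm (Fin n)) (f : MvPolynomial (Fin n) ℚ) :
    betaExp n x y (rename e f) = betaExp n x y f := by
  suffices h : betaExp n x y ∘ₗ (rename e).toLinearMap = betaExp n x y from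
    LinearMap.congr_fun h f
  refine (basisMonomials (Fin n) ℚ).ext fun a => ?_
  simp only [coe_basisMonomials, LinearMap.comp_apply, AlgHom.toLinearMap_apply, rename_monomial,
    betaExp_monomial]
  rw [← Equiv.prod_comp e]
  simp [Finsupp.mapDomain_apply e.injective]

theorem betaExp_prod_X_pow_mul {n : ℕ} {x y : ℚ} (m : ℕ) (f : MvPolynomial (Fin n) ℚ) :
    betaExp n x y ((∏ k, X k) ^ m * f) = betaMoment x y m ^ n * betaExp n (x + m) y f := by
  suffices h : betaExp n x y ∘ₗ LinearMap.mulLeft ℚ ((∏ k, X k) ^ m) =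
      betaMoment x y m ^ n • betaExp n (x + m) y from LinearMap.congr_fun h f
  refine (basisMonomials (Fin n) ℚ).ext fun a => ?_
  have h : (∏ k, X k : MvPolynomial (Fin n) ℚ) ^ m * monomial a 1 =
      monomial (Finsupp.equivFunOnFinite.symm (fun _ => m) + a) 1 := by
    simp [monomial_eq, Finsupp.prod_fintype, ← Finset.prod_mul_distrib, pow_add,
      ← Finset.prod_pow]
  simp [h, betaExp_monomial, betaMoment_add, Finset.prod_mul_distrib]

theorem betaExp_integration_by_parts {n : ℕ} {x y : ℚ} (hx : 0 < x) (hy : 0 < y) (i : Fin n)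
    (f : MvPolynomial (Fin n) ℚ) :
    x * betaExp n x y f - (x + y) * betaExp n x y (X i * f) +
      betaExp n x y (X i * (1 - X i) * pderiv i f) = 0 := by
  suffices h : x • betaExp n x y - (x + y) • betaExp n x y ∘ₗ LinearMap.mulLeft ℚ (X i) +
      betaExp n x y ∘ₗ LinearMap.mulLeft ℚ (X i * (1 - X i)) ∘ₗ
        (pderiv i : Derivation ℚ _ (MvPolynomial (Fin n) ℚ)).toLinearMap = 0 from
    LinearMap.congr_fun h f
  refine (basisMonomials (Fin n) ℚ).ext fun a => ?_
  have h1 : (X i : MvPolynomial (Fin n) ℚ) * monomial a 1 = monomial (a + Finsupp.single i 1) 1 := by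
    rw [X, monomial_mul, one_mul, add_comm]
  have h2 : (X i * (1 - X i) : MvPolynomial (Fin n) ℚ) * pderiv i (monomial a 1) =
      (a i : ℚ) • (monomial a 1 - monomial (a + Finsupp.single i 1) 1) := by
    rw [mul_comm (X i), mul_assoc, X_mul_pderiv_monomial, ← h1, smul_eq_C_mul, nsmul_eq_mul]
    simp only [map_natCast]
    ring
  have h3 : betaExp n x y (monomial (a + Finsupp.single i 1) 1) =
      betaMoment x y (a i + 1) * ∏ k ∈ Finset.univ.erase i, betaMoment x y (a k) := by
    rw [betaExp_monomial, ← Finset.mul_prod_erase _ _ (Finset.mem_univ i)]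
    congr 1
    · simp
    · refine Finset.prod_congr rfl fun k hk => ?_
      simp [Finsupp.single_eq_of_ne (Finset.ne_of_mem_erase hk)]
  have h4 : betaExp n x y (monomial a 1) =
      betaMoment x y (a i) * ∏ k ∈ Finset.univ.erase i, betaMoment x y (a k) := by
    rw [betaExp_monomial, ← Finset.mul_prod_erase _ _ (Finset.mem_univ i)]
  have h5 := betaMoment_succ hx hy (a i)
  simp only [coe_basisMonomials, LinearMap.add_apply, LinearMap.sub_apply, LinearMap.smul_apply,
    LinearMap.comp_apply, LinearMap.mulLeft_apply, Derivation.coeFn_coe, h1, h2, map_smul, map_sub,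
    LinearMap.zero_apply, smul_eq_mul, h3, h4]
  linear_combination -(∏ k ∈ Finset.univ.erase i, betaMoment x y (a k)) * h5

theorem betaExp_integration_by_parts_one {n : ℕ} {y : ℚ} (hy : 0 < y)
    (f : MvPolynomial (Fin (n + 1)) ℚ) :
    betaExp (n + 1) 1 y ((1 - X 0) * pderiv 0 f) - y * betaExp (n + 1) 1 y f =
      -y * betaExp n 1 y (aeval (Fin.cons 0 X : Fin (n + 1) → MvPolynomial (Fin n) ℚ) f) := by
  suffices h : betaExp (n + 1) 1 y ∘ₗ LinearMap.mulLeft ℚ (1 - X 0) ∘ₗ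
        (pderiv 0 : Derivation ℚ _ (MvPolynomial (Fin (n + 1)) ℚ)).toLinearMap -
        y • betaExp (n + 1) 1 y =
      -y • betaExp n 1 y ∘ₗ
        (aeval (Fin.cons 0 X : Fin (n + 1) → MvPolynomial (Fin n) ℚ)).toLinearMap from
    LinearMap.congr_fun h f
  refine (basisMonomials (Fin (n + 1)) ℚ).ext fun a => ?_
  have h0 : aeval (Fin.cons 0 X : Fin (n + 1) → MvPolynomial (Fin n) ℚ) (monomial a (1 : ℚ)) =
      0 ^ a 0 * monomial a.tail 1 := by
    rw [aeval_monomial, Finsupp.prod_fintype _ _ (by simp), Fin.prod_univ_succ]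
    simp [monomial_eq, Finsupp.prod_fintype, Finsupp.tail_apply]
  have h4 : ∀ b : Fin (n + 1) →₀ ℕ, betaExp (n + 1) 1 y (monomial b 1) =
      betaMoment 1 y (b 0) * betaExp n 1 y (monomial b.tail 1) := by
    intro b
    simp [betaExp_monomial, Fin.prod_univ_succ, Finsupp.tail_apply]
  simp only [coe_basisMonomials, LinearMap.sub_apply, LinearMap.smul_apply,
    LinearMap.comp_apply, LinearMap.mulLeft_apply, Derivation.coeFn_coe, smul_eq_mul,
    AlgHom.toLinearMap_apply]
  rw [h0]
  rcases ha : a 0 with _ | m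
  · have h1 : pderiv 0 (monomial a (1 : ℚ)) = 0 := by simp [pderiv_monomial, ha]
    simp [h1, h4, ha, betaMoment, risingFactorial_zero]
  · obtain ⟨b, rfl⟩ : ∃ b, a = b + Finsupp.single 0 1 :=
      ⟨a - Finsupp.single 0 1, (tsub_add_cancel_of_le (by simp [ha])).symm⟩
    have hb : b 0 = m := by simpa using ha
    have h1 : pderiv 0 (monomial (b + Finsupp.single 0 1) (1 : ℚ)) =
        ((m : ℚ) + 1) • monomial b 1 := by
      simp [pderiv_monomial, hb, smul_monomial]
    have h2 : (X 0 : MvPolynomial (Fin (n + 1)) ℚ) * monomial b 1 =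
        monomial (b + Finsupp.single 0 1) 1 := by
      rw [X, monomial_mul, one_mul, add_comm b]
    have h3 : (b + Finsupp.single 0 1).tail = b.tail := by
      ext k; simp [Finsupp.tail_apply]
    have h5 := betaMoment_succ one_pos hy m
    rw [h1, mul_smul_comm, map_smul, sub_mul, one_mul, h2, map_sub, h4, h4, h3]
    simp [hb]
    linear_combination -(betaExp n 1 y (monomial b.tail 1)) * h5

theorem prod_pairs_eq_prod_Ioi {M : Type*} [CommMonoid M] {n : ℕ} (f : Fin n → Fin n → M) :
    ∏ q : {q : Fin n × Fin n // q.1 < q.2}, f q.1.1 q.1.2 = ∏ i, ∏ j with i < j, f i j := by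
  rw [← Finset.prod_subtype (Finset.univ.filter fun q : Fin n × Fin n => q.1 < q.2) (by simp)
    fun q => f q.1 q.2, Finset.prod_filter, Fintype.prod_prod_type]
  simp [Finset.prod_filter]

theorem prod_pairs_eq_prod_Iio {M : Type*} [CommMonoid M] {n : ℕ} (f : Fin n → Fin n → M) :
    ∏ q : {q : Fin n × Fin n // q.1 < q.2}, f q.1.1 q.1.2 = ∏ j, ∏ i with i < j, f i j := by
  rw [← Finset.prod_subtype (Finset.univ.filter fun q : Fin n × Fin n => q.1 < q.2) (by simp)
    fun q => f q.1 q.2, Finset.prod_filter, Fintype.prod_prod_type_right]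
  simp [Finset.prod_filter]

/-- The product of the differences `t_j - t_i` over all `i < j`. -/
noncomputable def diffProd (n : ℕ) : MvPolynomial (Fin n) ℚ :=
  ∏ q : {q : Fin n × Fin n // q.1 < q.2}, (X q.1.2 - X q.1.1)

theorem diffProd_eq_det (n : ℕ) : diffProd n = (Matrix.vandermonde X).det := by
  rw [diffProd, prod_pairs_eq_prod_Ioi fun i j => (X j - X i : MvPolynomial (Fin n) ℚ),
    Matrix.det_vandermonde]
  simp [← Finset.filter_lt_eq_Ioi]

theorem rename_swap_diffProd {n : ℕ} {i j : Fin n} (hij : i ≠ j) :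
    rename (Equiv.swap i j) (diffProd n) = -diffProd n := by
  rw [diffProd_eq_det, AlgHom.map_det]
  have h : (rename (Equiv.swap i j)).mapMatrix (Matrix.vandermonde X) =
      (Matrix.vandermonde (X : Fin n → MvPolynomial (Fin n) ℚ)).submatrix (Equiv.swap i j) id := by
    ext1 a b
    simp [Matrix.vandermonde_apply]
  rw [h, Matrix.det_permute, Equiv.Perm.sign_swap hij]
  simp

/-- The quotient of `diffProd n` by `t_i - t_j`. -/
noncomputable def diffQuot {n : ℕ} (i j : Fin n) : MvPolynomial (Fin n) ℚ :=
  if h : i < j then -∏ q ∈ Finset.univ.erase (⟨(i, j), h⟩ : {q : Fin n × Fin n // q.1 < q.2}),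
    (X q.1.2 - X q.1.1)
  else if h : j < i then ∏ q ∈ Finset.univ.erase (⟨(j, i), h⟩ : {q : Fin n × Fin n // q.1 < q.2}),
    (X q.1.2 - X q.1.1)
  else 0

theorem sub_mul_diffQuot {n : ℕ} {i j : Fin n} (hij : i ≠ j) :
    (X i - X j) * diffQuot i j = diffProd n := by
  rcases lt_or_gt_of_ne hij with h | h
  · rw [diffQuot, dif_pos h, diffProd,
      ← Finset.mul_prod_erase _ _ (Finset.mem_univ ⟨(i, j), h⟩)]
    ring
  · rw [diffQuot, dif_neg h.not_gt, dif_pos h, diffProd,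
      ← Finset.mul_prod_erase _ _ (Finset.mem_univ ⟨(j, i), h⟩)]

theorem diffQuot_self {n : ℕ} (i : Fin n) : diffQuot i i = 0 := by
  simp [diffQuot]

theorem rename_swap_diffQuot {n : ℕ} {i j : Fin n} (hij : i ≠ j) :
    rename (Equiv.swap i j) (diffQuot i j) = diffQuot i j := by
  have h : (X i - X j : MvPolynomial (Fin n) ℚ) ≠ 0 := sub_ne_zero.2 (X_injective.ne hij)
  refine mul_left_cancel₀ h ?_
  have h1 := congrArg (rename (Equiv.swap i j)) (sub_mul_diffQuot hij)
  rw [map_mul, rename_swap_diffProd hij, ← sub_mul_diffQuot hij] at h1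
  simp only [map_sub, rename_X, Equiv.swap_apply_left, Equiv.swap_apply_right] at h1
  linear_combination -h1

theorem pderiv_diffProd {n : ℕ} (i : Fin n) :
    pderiv i (diffProd n) = ∑ j, diffQuot i j := by
  have key : ∀ s : Finset {q : Fin n × Fin n // q.1 < q.2},
      pderiv i (∏ q ∈ s, (X q.1.2 - X q.1.1 : MvPolynomial (Fin n) ℚ)) =
        ∑ q ∈ s, (∏ p ∈ s.erase q, (X p.1.2 - X p.1.1)) * pderiv i (X q.1.2 - X q.1.1) := by
    intro s
    induction s using Finset.induction_on with
    | empty => simp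
    | insert a s ha ih =>
      rw [Finset.prod_insert ha, Derivation.leibniz, ih, Finset.sum_insert ha,
        Finset.erase_insert ha, smul_eq_mul, smul_eq_mul, Finset.mul_sum, add_comm]
      congr 1
      refine Finset.sum_congr rfl fun q hq => ?_
      have hqa : a ≠ q := fun h => ha (h ▸ hq)
      rw [Finset.erase_insert_of_ne hqa, Finset.prod_insert (by simp [ha]), mul_assoc]
  let g : Fin n → Fin n → MvPolynomial (Fin n) ℚ := fun a b =>
    diffQuot b a * Pi.single (M := fun _ => MvPolynomial (Fin n) ℚ) i 1 b
  have h : ∀ q : {q : Fin n × Fin n // q.1 < q.2},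
      (∏ p ∈ Finset.univ.erase q, (X p.1.2 - X p.1.1)) *
        pderiv i (X q.1.2 - X q.1.1 : MvPolynomial (Fin n) ℚ) = g q.1.1 q.1.2 + g q.1.2 q.1.1 := by
    rintro ⟨⟨a, b⟩, hab⟩
    have hab' : a < b := hab
    simp only [g, diffQuot, dif_pos hab', dif_neg hab'.not_gt, map_sub, pderiv_X, Pi.single_apply]
    simp only [eq_comm]
    ring
  have h1 := congrArg Multiplicative.toAdd
    (prod_pairs_eq_prod_Iio fun a b => Multiplicative.ofAdd (g a b))
  have h2 := congrArg Multiplicative.toAdd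
    (prod_pairs_eq_prod_Ioi fun a b => Multiplicative.ofAdd (g b a))
  simp only [toAdd_prod, toAdd_ofAdd] at h1 h2
  rw [diffProd, key, Finset.sum_congr rfl fun q _ => h q, Finset.sum_add_distrib, h1, h2,
    ← Finset.sum_add_distrib]
  have h3 : ∀ b, (∑ a with a < b, g a b) + ∑ a with b < a, g a b = ∑ a, g a b := by
    intro b
    rw [Finset.sum_filter, Finset.sum_filter, ← Finset.sum_add_distrib]
    refine Finset.sum_congr rfl fun a _ => ?_
    rcases lt_trichotomy a b with h | rfl | h
    · simp [h, h.not_gt]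
    · simp [g, diffQuot_self]
    · simp [h, h.not_gt]
  rw [Finset.sum_congr rfl fun b _ => h3 b]
  simp only [g, ← Finset.sum_mul]
  rw [Finset.sum_eq_single i (by simp +contextual) (by simp)]
  simp

theorem diffProd_succ (n : ℕ) :
    aeval (Fin.cons 0 X : Fin (n + 1) → MvPolynomial (Fin n) ℚ) (diffProd (n + 1)) =
      (∏ k, X k) * diffProd n := by
  rw [diffProd_eq_det, diffProd_eq_det, Matrix.det_vandermonde, Matrix.det_vandermonde,
    Fin.prod_univ_succ]
  simp [Fin.prod_Ioi_succ, map_prod]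

theorem betaExp_eq_half_of_rename_eq_neg {n : ℕ} {x y : ℚ} (e : Equiv.Perm (Fin n))
    {f g : MvPolynomial (Fin n) ℚ} (h : rename e (2 * f - g) = -(2 * f - g)) :
    betaExp n x y f = 1 / 2 * betaExp n x y g := by
  have h1 := betaExp_rename x y e (2 * f - g)
  rw [h, map_neg, two_mul, map_sub, map_add] at h1
  linarith

section

variable {n c : ℕ} {x y : ℚ} {i j : Fin n}

theorem diffProd_pow_eq (hc : 1 ≤ c) (hij : i ≠ j) :
    diffProd n ^ (2 * c) = (X i - X j) * (diffProd n ^ (2 * c - 1) * diffQuot i j) := by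
  obtain ⟨m, hm⟩ : ∃ m, 2 * c = m + 1 := ⟨2 * c - 1, by omega⟩
  rw [hm, Nat.add_sub_cancel, pow_succ, ← sub_mul_diffQuot hij]
  ring

theorem rename_swap_diffProd_pow_mul_diffQuot (hc : 1 ≤ c) (hij : i ≠ j) :
    rename (Equiv.swap i j) (diffProd n ^ (2 * c - 1) * diffQuot i j) =
      -(diffProd n ^ (2 * c - 1) * diffQuot i j) := by
  have h : Odd (2 * c - 1) := ⟨c - 1, by omega⟩
  rw [map_mul, map_pow, rename_swap_diffProd hij, rename_swap_diffQuot hij, h.neg_pow, neg_mul]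

theorem pderiv_diffProd_pow :
    pderiv i (diffProd n ^ (2 * c)) =
      (2 * c : ℚ) • ∑ j ∈ Finset.univ.erase i, diffProd n ^ (2 * c - 1) * diffQuot i j := by
  rw [Derivation.leibniz_pow, pderiv_diffProd, ← Finset.mul_sum,
    Finset.sum_erase _ (diffQuot_self i), smul_eq_mul, ← Nat.cast_smul_eq_nsmul ℚ]
  push_cast
  rfl

theorem rename_swap_prod_X_of_mem {T : Finset (Fin n)} (hi : i ∉ T) (hj : j ∈ T) :
    rename (Equiv.swap i j) (X i * ∏ k ∈ T, X k : MvPolynomial (Fin n) ℚ) =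
      X i * ∏ k ∈ T, X k := by
  rw [← Finset.mul_prod_erase _ _ hj, map_mul, map_mul, map_prod,
    Finset.prod_congr rfl fun k hk => ?_]
  · simp only [rename_X, Equiv.swap_apply_left, Equiv.swap_apply_right]
    ring
  · rw [rename_X, Equiv.swap_apply_of_ne_of_ne]
    · rintro rfl
      exact hi (Finset.mem_of_mem_erase hk)
    · exact Finset.ne_of_mem_erase hk

theorem rename_swap_prod_X_of_notMem {T : Finset (Fin n)} (hi : i ∉ T) (hj : j ∉ T) :
    rename (Equiv.swap i j) (∏ k ∈ T, X k : MvPolynomial (Fin n) ℚ) = ∏ k ∈ T, X k := by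
  rw [map_prod]
  refine Finset.prod_congr rfl fun k hk => ?_
  rw [rename_X, Equiv.swap_apply_of_ne_of_ne]
  · rintro rfl
    exact hi hk
  · rintro rfl
    exact hj hk

theorem betaExp_diffQuot_of_mem (hc : 1 ≤ c) {T : Finset (Fin n)} (hi : i ∉ T) (hj : j ∈ T) :
    betaExp n x y (X i * (1 - X i) * ((∏ k ∈ T, X k) * (diffProd n ^ (2 * c - 1) * diffQuot i j))) =
      -(1 / 2) * betaExp n x y (X i * ((∏ k ∈ T, X k) * diffProd n ^ (2 * c))) := by
  have hij : i ≠ j := fun h => hi (h ▸ hj)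
  have hP := rename_swap_prod_X_of_mem hi hj
  have hQ := rename_swap_diffProd_pow_mul_diffQuot hc hij
  rw [diffProd_pow_eq hc hij, neg_mul, ← mul_neg, ← map_neg]
  set Q := diffProd n ^ (2 * c - 1) * diffQuot i j
  refine betaExp_eq_half_of_rename_eq_neg (Equiv.swap i j) ?_
  rw [show 2 * (X i * (1 - X i) * ((∏ k ∈ T, X k) * Q)) -
      -(X i * ((∏ k ∈ T, X k) * ((X i - X j) * Q))) =
    (2 - X i - X j) * (X i * ∏ k ∈ T, X k) * Q by ring, map_mul, map_mul, hP, hQ]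
  simp only [map_sub, rename_X, Equiv.swap_apply_left, Equiv.swap_apply_right, map_ofNat]
  ring

theorem betaExp_diffQuot_of_notMem (hc : 1 ≤ c) {T : Finset (Fin n)} (hi : i ∉ T) (hj : j ∉ T)
    (hij : i ≠ j) :
    betaExp n x y (X i * (1 - X i) * ((∏ k ∈ T, X k) * (diffProd n ^ (2 * c - 1) * diffQuot i j))) =
      1 / 2 * betaExp n x y ((∏ k ∈ T, X k) * diffProd n ^ (2 * c)) -
        betaExp n x y (X i * ((∏ k ∈ T, X k) * diffProd n ^ (2 * c))) := by
  have hP := rename_swap_prod_X_of_notMem hi hj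
  have hQ := rename_swap_diffProd_pow_mul_diffQuot hc hij
  rw [diffProd_pow_eq hc hij]
  set Q := diffProd n ^ (2 * c - 1) * diffQuot i j
  rw [eq_sub_iff_add_eq, ← map_add]
  refine betaExp_eq_half_of_rename_eq_neg (Equiv.swap i j) ?_
  simp only [map_mul, map_sub, map_add, hP, hQ, rename_X, Equiv.swap_apply_left,
    Equiv.swap_apply_right, map_ofNat, map_one]
  ring

theorem betaExp_insert (hc : 1 ≤ c) (hx : 0 < x) (hy : 0 < y) {T : Finset (Fin n)} (hi : i ∉ T) :
    (x + y + c * (2 * n - 2 - T.card)) *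
        betaExp n x y ((∏ k ∈ insert i T, X k) * diffProd n ^ (2 * c)) =
      (x + c * (n - 1 - T.card)) * betaExp n x y ((∏ k ∈ T, X k) * diffProd n ^ (2 * c)) := by
  have h := betaExp_integration_by_parts hx hy i ((∏ k ∈ T, X k) * diffProd n ^ (2 * c))
  have hP : pderiv i (∏ k ∈ T, X k : MvPolynomial (Fin n) ℚ) = 0 := by
    refine pderiv_eq_zero_of_notMem_vars fun hv => ?_
    obtain ⟨k, hk, hik⟩ := Finset.mem_biUnion.1 (vars_prod _ hv)
    rw [vars_X, Finset.mem_singleton] at hik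
    exact hi (hik ▸ hk)
  rw [Derivation.leibniz, hP, smul_zero, add_zero, pderiv_diffProd_pow, smul_eq_mul,
    mul_smul_comm, mul_smul_comm, map_smul, Finset.mul_sum, Finset.mul_sum, map_sum] at h
  have hT : T ⊆ Finset.univ.erase i := fun k hk =>
    Finset.mem_erase.2 ⟨fun h => hi (h ▸ hk), Finset.mem_univ k⟩
  rw [← Finset.sum_sdiff hT, Finset.sum_congr rfl fun j hj => betaExp_diffQuot_of_notMem hc hi
      (Finset.mem_sdiff.1 hj).2 (Finset.ne_of_mem_erase (Finset.mem_sdiff.1 hj).1).symm,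
    Finset.sum_congr (s₁ := T) rfl fun j hj => betaExp_diffQuot_of_mem hc hi hj,
    Finset.sum_const, Finset.sum_const, Finset.card_sdiff_of_subset hT, nsmul_eq_mul, nsmul_eq_mul,
    Nat.cast_sub (Finset.card_le_card hT), Finset.card_erase_of_mem (Finset.mem_univ i),
    Finset.card_univ, Fintype.card_fin, Nat.cast_sub i.pos, smul_eq_mul] at h
  rw [Finset.prod_insert hi, mul_assoc]
  push_cast at h
  linear_combination -h

end

theorem betaExp_diffProd_add_one {n c : ℕ} {x y : ℚ} (hc : 1 ≤ c) (hx : 0 < x) (hy : 0 < y) :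
    (∏ k ∈ Finset.range n, (x + y + c * (2 * n - 2 - k))) *
        ((x / (x + y)) ^ n * betaExp n (x + 1) y (diffProd n ^ (2 * c))) =
      (∏ k ∈ Finset.range n, (x + c * (n - 1 - k))) * betaExp n x y (diffProd n ^ (2 * c)) := by
  have key : ∀ T : Finset (Fin n), (∏ k ∈ Finset.range T.card, (x + y + c * (2 * n - 2 - k))) *
        betaExp n x y ((∏ k ∈ T, X k) * diffProd n ^ (2 * c)) =
      (∏ k ∈ Finset.range T.card, (x + c * (n - 1 - k))) *
        betaExp n x y (diffProd n ^ (2 * c)) := by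
    intro T
    induction T using Finset.induction_on with
    | empty => simp
    | insert i T hi ih =>
      rw [Finset.card_insert_of_notMem hi, Finset.prod_range_succ, Finset.prod_range_succ,
        mul_assoc, betaExp_insert hc hx hy hi]
      linear_combination (x + c * (n - 1 - T.card)) * ih
  have h := key Finset.univ
  have h1 := betaExp_prod_X_pow_mul (x := x) (y := y) 1 (diffProd n ^ (2 * c))
  rw [pow_one] at h1
  rw [h1] at h
  simpa [betaMoment, risingFactorial] using h

theorem betaExp_diffProd_one {n c : ℕ} {y : ℚ} (hc : 1 ≤ c) (hy : 0 < y) :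
    (y + c * n) * betaExp (n + 1) 1 y (diffProd (n + 1) ^ (2 * c)) =
      y * (betaMoment 1 y (2 * c) ^ n * betaExp n (1 + 2 * c) y (diffProd n ^ (2 * c))) := by
  have h := betaExp_integration_by_parts_one hy (diffProd (n + 1) ^ (2 * c))
  rw [map_pow (aeval _), diffProd_succ, mul_pow, betaExp_prod_X_pow_mul, pderiv_diffProd_pow,
    mul_smul_comm, map_smul, Finset.mul_sum, map_sum] at h
  have h1 : ∀ j ∈ Finset.univ.erase (0 : Fin (n + 1)), betaExp (n + 1) 1 y
      ((1 - X 0) * (diffProd (n + 1) ^ (2 * c - 1) * diffQuot 0 j)) =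
      -(1 / 2) * betaExp (n + 1) 1 y (diffProd (n + 1) ^ (2 * c)) := by
    intro j hj
    have hij := (Finset.ne_of_mem_erase hj).symm
    have hQ := rename_swap_diffProd_pow_mul_diffQuot hc hij
    rw [diffProd_pow_eq hc hij, neg_mul, ← mul_neg, ← map_neg]
    set Q := diffProd (n + 1) ^ (2 * c - 1) * diffQuot 0 j
    refine betaExp_eq_half_of_rename_eq_neg (Equiv.swap 0 j) ?_
    simp only [map_mul, map_sub, map_neg, hQ, rename_X, Equiv.swap_apply_left,
      Equiv.swap_apply_right, map_ofNat, map_one]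
    ring
  rw [Finset.sum_congr rfl h1, Finset.sum_const, Finset.card_erase_of_mem (Finset.mem_univ _),
    Finset.card_univ, Fintype.card_fin, nsmul_eq_mul, smul_eq_mul] at h
  push_cast at h
  linear_combination -h

/-- The expectation of a univariate polynomial in a beta variable with parameters `x`, `y`. -/
noncomputable def betaExpUni (x y : ℚ) : Polynomial ℚ →ₗ[ℚ] ℚ :=
  (Polynomial.basisMonomials ℚ).constr ℚ (betaMoment x y)

theorem betaExpUni_X_pow (x y : ℚ) (a : ℕ) :
    betaExpUni x y (Polynomial.X ^ a) = betaMoment x y a := by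
  simpa [betaExpUni, Polynomial.X_pow_eq_monomial] using
    (Polynomial.basisMonomials ℚ).constr_basis ℚ (betaMoment x y) a

theorem betaExpUni_X_pow_mul {x y : ℚ} (hx : 0 < x) (hy : 0 < y) (a b : ℕ) :
    betaExpUni x y (Polynomial.X ^ a * (1 - Polynomial.X) ^ b) =
      risingFactorial x a * risingFactorial y b / risingFactorial (x + y) (a + b) := by
  induction b generalizing a with
  | zero => simp [betaExpUni_X_pow, betaMoment, risingFactorial_zero]
  | succ b ih =>
    have h : (Polynomial.X ^ a * (1 - Polynomial.X) ^ (b + 1) : Polynomial ℚ) =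
        Polynomial.X ^ a * (1 - Polynomial.X) ^ b -
          Polynomial.X ^ (a + 1) * (1 - Polynomial.X) ^ b := by ring
    have h1 := (risingFactorial_pos (add_pos hx hy) (a + b)).ne'
    have h2 : x + y + ((a + b : ℕ) : ℚ) ≠ 0 := by positivity
    rw [h, map_sub, ih, ih, add_right_comm, ← add_assoc, risingFactorial_succ,
      risingFactorial_succ, risingFactorial_succ]
    field_simp
    push_cast
    ring

theorem betaExp_prod (n : ℕ) (x y : ℚ) (p : Fin n → Polynomial ℚ) :
    betaExp n x y (∏ k, Polynomial.aeval (X k) (p k)) = ∏ k, betaExpUni x y (p k) := by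
  let f : MultilinearMap ℚ (fun _ : Fin n => Polynomial ℚ) ℚ :=
    (betaExp n x y).compMultilinearMap
      ((MultilinearMap.mkPiAlgebra ℚ (Fin n) (MvPolynomial (Fin n) ℚ)).compLinearMap
        fun k => (Polynomial.aeval (X k)).toLinearMap)
  let g : MultilinearMap ℚ (fun _ : Fin n => Polynomial ℚ) ℚ :=
    (MultilinearMap.mkPiAlgebra ℚ (Fin n) ℚ).compLinearMap fun _ => betaExpUni x y
  suffices h : f = g by simpa [f, g] using congrArg (fun φ => φ p) h
  refine Module.Basis.ext_multilinear (fun _ => Polynomial.basisMonomials ℚ) fun a => ?_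
  have h : ∏ k, (X k : MvPolynomial (Fin n) ℚ) ^ a k =
      monomial (Finsupp.equivFunOnFinite.symm a) 1 := by
    simp [monomial_eq, Finsupp.prod_fintype]
  simp [f, g, ← Polynomial.X_pow_eq_monomial, betaExpUni_X_pow, h, betaExp_monomial]

theorem betaExp_prod_X_pow {n : ℕ} {x y : ℚ} (hx : 0 < x) (hy : 0 < y) (r s : Fin n → ℕ) :
    betaExp n x y (∏ k, X k ^ r k * (1 - X k) ^ s k) =
      ∏ k, (risingFactorial x (r k) * risingFactorial y (s k) /
        risingFactorial (x + y) (r k + s k)) := by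
  have h := betaExp_prod n x y fun k => Polynomial.X ^ r k * (1 - Polynomial.X) ^ s k
  simpa [betaExpUni_X_pow_mul hx hy] using h

section

variable {n c : ℕ} (m : {q : Fin n × Fin n // q.1 < q.2} → Fin (2 * c + 1))

theorem mVal_val (q : {q : Fin n × Fin n // q.1 < q.2}) : mVal n c m q.1.1 q.1.2 = m q :=
  dif_pos q.2

theorem prod_pow_rVal {M : Type*} [CommMonoid M] (t : Fin n → M) :
    ∏ k, t k ^ rVal n c m k = ∏ q, t q.1.2 ^ (2 * c - (m q : ℕ)) * t q.1.1 ^ (m q : ℕ) := by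
  simp only [rVal, pow_add, Finset.prod_mul_distrib, ← Finset.prod_pow_eq_pow_sum, ← mVal_val m]
  rw [prod_pairs_eq_prod_Iio fun i j => t j ^ (2 * c - mVal n c m i j),
    prod_pairs_eq_prod_Ioi fun i j => t i ^ mVal n c m i j]

theorem prod_pow_sVal {M : Type*} [CommMonoid M] (t : Fin n → M) :
    ∏ k, t k ^ sVal n c m k = ∏ q, t q.1.2 ^ (m q : ℕ) * t q.1.1 ^ (2 * c - (m q : ℕ)) := by
  simp only [sVal, pow_add, Finset.prod_mul_distrib, ← Finset.prod_pow_eq_pow_sum, ← mVal_val m]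
  rw [prod_pairs_eq_prod_Iio fun i j => t j ^ mVal n c m i j,
    prod_pairs_eq_prod_Ioi fun i j => t i ^ (2 * c - mVal n c m i j)]

theorem rVal_add_sVal (k : Fin n) : rVal n c m k + sVal n c m k = 2 * c * (n - 1) := by
  have h : ∀ i j, mVal n c m i j ≤ 2 * c := by
    intro i j
    unfold mVal
    split <;> omega
  have h1 : ∑ i with i < k, (2 * c - mVal n c m i k) + ∑ i with i < k, mVal n c m i k =
      k * (2 * c) := by
    rw [← Finset.sum_add_distrib, Finset.sum_congr rfl fun i _ => Nat.sub_add_cancel (h i k)]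
    simp [Finset.filter_gt_eq_Iio]
  have h2 : ∑ i with k < i, mVal n c m k i + ∑ i with k < i, (2 * c - mVal n c m k i) =
      (n - 1 - k) * (2 * c) := by
    rw [← Finset.sum_add_distrib, Finset.sum_congr rfl fun i _ => Nat.add_sub_cancel' (h k i)]
    simp [Finset.filter_lt_eq_Ioi]
  have h3 : (k : ℕ) + (n - 1 - k) = n - 1 := by omega
  rw [rVal, sVal, add_add_add_comm, h1, h2, ← add_mul, h3, mul_comm]

end

theorem diffProd_pow_eq_sum (n c : ℕ) :
    diffProd n ^ (2 * c) = ∑ m : {q : Fin n × Fin n // q.1 < q.2} → Fin (2 * c + 1),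
      ((-1) ^ (∑ q, (m q : ℕ)) * ∏ q, (Nat.choose (2 * c) (m q) : ℚ)) •
        ∏ k, X k ^ rVal n c m k * (1 - X k) ^ sVal n c m k := by
  have h : ∀ q : {q : Fin n × Fin n // q.1 < q.2},
      (X q.1.2 - X q.1.1 : MvPolynomial (Fin n) ℚ) ^ (2 * c) = ∑ m : Fin (2 * c + 1),
        C ((-1) ^ (m : ℕ) * (Nat.choose (2 * c) m : ℚ)) *
          (X q.1.2 ^ (2 * c - (m : ℕ)) * X q.1.1 ^ (m : ℕ) *
          ((1 - X q.1.2) ^ (m : ℕ) * (1 - X q.1.1) ^ (2 * c - (m : ℕ)))) := by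
    intro q
    rw [show (X q.1.2 - X q.1.1 : MvPolynomial (Fin n) ℚ) =
      -1 * (X q.1.1 * (1 - X q.1.2)) + X q.1.2 * (1 - X q.1.1) by ring, add_pow, Finset.sum_range]
    refine Finset.sum_congr rfl fun m _ => ?_
    simp only [mul_pow, C_mul, C_pow, C_neg, C_1, map_natCast]
    ring
  rw [diffProd, ← Finset.prod_pow, Finset.prod_congr rfl fun q _ => h q, Finset.prod_univ_sum,
    Fintype.piFinset_univ]
  refine Finset.sum_congr rfl fun m _ => ?_
  rw [Finset.prod_mul_distrib, Finset.prod_mul_distrib, ← prod_pow_rVal m X,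
    ← prod_pow_sVal m fun k => (1 - X k : MvPolynomial (Fin n) ℚ), ← Finset.prod_mul_distrib,
    ← map_prod, Finset.prod_mul_distrib, Finset.prod_pow_eq_pow_sum, smul_eq_C_mul]

theorem sum_eq_betaExp {x y : ℚ} (hx : 0 < x) (hy : 0 < y) (n c : ℕ) :
    ∑ m : {q : Fin n × Fin n // q.1 < q.2} → Fin (2 * c + 1),
      ((-1) ^ (∑ q, (m q : ℕ)) * (∏ q, (Nat.choose (2 * c) (m q) : ℚ)) *
        ∏ k : Fin n, risingFactorial x (rVal n c m k) * risingFactorial y (sVal n c m k)) =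
      risingFactorial (x + y) (2 * c * (n - 1)) ^ n * betaExp n x y (diffProd n ^ (2 * c)) := by
  have h := (risingFactorial_pos (add_pos hx hy) (2 * c * (n - 1))).ne'
  rw [diffProd_pow_eq_sum, map_sum, Finset.mul_sum]
  refine Finset.sum_congr rfl fun m _ => ?_
  rw [map_smul, betaExp_prod_X_pow hx hy]
  simp only [rVal_add_sVal, Finset.prod_div_distrib, Finset.prod_const, Finset.card_univ,
    Fintype.card_fin, smul_eq_mul]
  field_simp

/-- The closed form of the normalised Selberg integral with even exponent `2 * c`. -/
noncomputable def selbergValue (n c : ℕ) (x y : ℚ) : ℚ :=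
  ∏ j ∈ Finset.range n, (risingFactorial x (j * c) * risingFactorial y (j * c) *
    (((j + 1) * c).factorial / c.factorial) / risingFactorial (x + y) ((n - 1 + j) * c))

theorem selbergValue_add_one {n c : ℕ} {x y : ℚ} (hx : 0 < x) (hy : 0 < y) :
    (∏ k ∈ Finset.range n, (x + y + c * (2 * n - 2 - k))) *
        ((x / (x + y)) ^ n * selbergValue n c (x + 1) y) =
      (∏ k ∈ Finset.range n, (x + c * (n - 1 - k))) * selbergValue n c x y := by
  have h1 : ∏ k ∈ Finset.range n, (x + y + c * (2 * n - 2 - k)) =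
      ∏ k ∈ Finset.range n, (x + y + ((n - 1 + k : ℕ) * c : ℕ)) := by
    rw [← Finset.prod_range_reflect]
    refine Finset.prod_congr rfl fun k hk => ?_
    have hk' := Finset.mem_range.1 hk
    rw [Nat.cast_sub (by omega), Nat.cast_sub (by omega)]
    push_cast [Nat.cast_sub (show 1 ≤ n by omega)]
    ring
  have h2 : ∏ k ∈ Finset.range n, (x + c * (n - 1 - k)) =
      ∏ k ∈ Finset.range n, (x + (k * c : ℕ)) := by
    rw [← Finset.prod_range_reflect]
    refine Finset.prod_congr rfl fun k hk => ?_
    have hk' := Finset.mem_range.1 hk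
    rw [Nat.cast_sub (by omega), Nat.cast_sub (by omega)]
    push_cast
    ring
  have h3 : (x / (x + y)) ^ n = ∏ k ∈ Finset.range n, (x / (x + y)) := by
    rw [Finset.prod_const, Finset.card_range]
  rw [h1, h2, h3, selbergValue, selbergValue, ← Finset.prod_mul_distrib, ← Finset.prod_mul_distrib,
    ← Finset.prod_mul_distrib]
  refine Finset.prod_congr rfl fun k _ => ?_
  have e1 := risingFactorial_shift x (k * c)
  have e2 := risingFactorial_shift (x + y) ((n - 1 + k) * c)
  rw [add_right_comm x y 1] at e2
  have p1 := (risingFactorial_pos (add_pos hx hy) ((n - 1 + k) * c)).ne'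
  have p2 := (risingFactorial_pos (show 0 < x + 1 + y by positivity) ((n - 1 + k) * c)).ne'
  have p3 := (add_pos hx hy).ne'
  rw [add_right_comm x 1 y] at *
  field_simp
  linear_combination risingFactorial y (k * c) *
    (risingFactorial (x + y) ((n - 1 + k) * c) * (x + y + ((n - 1 + k : ℕ) * c : ℕ)) * e1 -
      risingFactorial x (k * c) * (x + (k * c : ℕ)) * e2)

theorem selbergValue_one {n c : ℕ} {y : ℚ} (hy : 0 < y) :
    (y + c * n) * selbergValue (n + 1) c 1 y =
      y * (betaMoment 1 y (2 * c) ^ n * selbergValue n c (1 + 2 * c) y) := by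
  have f0 : (c.factorial : ℚ) ≠ 0 := by positivity
  have key : betaMoment 1 y (2 * c) ^ n * selbergValue n c (1 + 2 * c) y =
      ∏ j ∈ Finset.range n, (((j + 2) * c).factorial * risingFactorial y (j * c) *
        (((j + 1) * c).factorial / c.factorial) / risingFactorial (1 + y) ((n + 1 + j) * c)) := by
    have h3 : betaMoment 1 y (2 * c) ^ n = ∏ k ∈ Finset.range n, betaMoment 1 y (2 * c) := by simp
    rw [h3, selbergValue, ← Finset.prod_mul_distrib]
    refine Finset.prod_congr rfl fun j hj => ?_
    have hj' := Finset.mem_range.1 hj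
    have e1 := risingFactorial_add (1 : ℚ) (2 * c) (j * c)
    have e2 := risingFactorial_add (1 + y) (2 * c) ((n - 1 + j) * c)
    rw [← add_mul, risingFactorial_one, risingFactorial_one] at e1
    rw [← add_mul] at e2
    push_cast at e1 e2
    rw [show 2 + (n - 1 + j) = n + 1 + j by omega] at e2
    rw [add_comm j 2, e1, e2, betaMoment, risingFactorial_one, add_right_comm (1 : ℚ) (2 * c) y]
    rw [mul_div_assoc]
    simp only [div_eq_mul_inv, mul_inv]
    ring
  have e4 : ∏ j ∈ Finset.range (n + 1), (((j + 1) * c).factorial : ℚ) =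
      (∏ j ∈ Finset.range n, (((j + 2) * c).factorial : ℚ)) * c.factorial := by
    rw [Finset.prod_range_succ', zero_add, one_mul]
  have e5 : ∏ j ∈ Finset.range (n + 1), risingFactorial (1 + y) ((n + j) * c) =
      (∏ j ∈ Finset.range n, risingFactorial (1 + y) ((n + 1 + j) * c)) *
        risingFactorial (1 + y) (n * c) := by
    rw [Finset.prod_range_succ', add_zero]
    simp only [add_assoc, add_comm 1]
  rw [key, selbergValue]
  simp only [Finset.prod_div_distrib, Finset.prod_mul_distrib, risingFactorial_one,
    Nat.add_sub_cancel]
  rw [Finset.prod_range_succ' (fun j => ((j * c).factorial : ℚ)),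
    Finset.prod_range_succ (fun j => risingFactorial y (j * c)),
    e4, e5, Finset.prod_range_succ (fun j => (c.factorial : ℚ))]
  have e := risingFactorial_shift y (n * c)
  have p1 := (risingFactorial_pos (add_pos one_pos hy) (n * c)).ne'
  have p2 : ∏ j ∈ Finset.range n, risingFactorial (1 + y) ((n + 1 + j) * c) ≠ 0 :=
    Finset.prod_ne_zero_iff.2 fun j _ => (risingFactorial_pos (add_pos one_pos hy) _).ne'
  have p3 : ∏ j ∈ Finset.range n, (c.factorial : ℚ) ≠ 0 :=
    Finset.prod_ne_zero_iff.2 fun j _ => f0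
  rw [add_comm y 1] at e
  simp only [zero_mul, Nat.factorial_zero, Nat.cast_one, mul_one]
  field_simp
  push_cast at e
  linear_combination -(∏ j ∈ Finset.range n, risingFactorial y (j * c)) * e

theorem betaExp_diffProd_eq_selbergValue {c : ℕ} (hc : 1 ≤ c) {y : ℚ} (hy : 0 < y) (n k : ℕ) :
    betaExp n (1 + k) y (diffProd n ^ (2 * c)) = selbergValue n c (1 + k) y := by
  induction n generalizing k with
  | zero =>
    have h : diffProd 0 ^ (2 * c) = monomial 0 (1 : ℚ) := by simp [diffProd]
    rw [h, betaExp_monomial]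
    simp [selbergValue]
  | succ n ihn =>
    induction k with
    | zero =>
      have h1 := betaExp_diffProd_one (n := n) hc hy
      have h2 := selbergValue_one (n := n) (c := c) hy
      have h3 := ihn (2 * c)
      push_cast at h3
      rw [h3, ← h2] at h1
      simpa using mul_left_cancel₀ (by positivity) h1
    | succ k ihk =>
      have hx : (0 : ℚ) < 1 + k := by positivity
      have h1 := betaExp_diffProd_add_one (n := n + 1) hc hx hy
      rw [ihk, ← selbergValue_add_one hx hy] at h1
      have hp : ∏ j ∈ Finset.range (n + 1),
          (1 + (k : ℚ) + y + c * (2 * (n + 1 : ℕ) - 2 - j)) ≠ 0 := by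
        refine Finset.prod_ne_zero_iff.2 fun j hj => ?_
        have hj' : j ≤ n := Nat.lt_succ_iff.1 (Finset.mem_range.1 hj)
        have hj'' : (j : ℚ) ≤ n := by exact_mod_cast hj'
        have : (0 : ℚ) ≤ c * (2 * (n + 1 : ℕ) - 2 - j) := by
          push_cast
          exact mul_nonneg (by positivity) (by linarith [Nat.cast_nonneg (α := ℚ) n])
        positivity
      have h2 := mul_left_cancel₀ (by positivity) (mul_left_cancel₀ hp h1)
      push_cast
      rwa [← add_assoc]

theorem selbergValue_eq {n c : ℕ} (hn : 2 ≤ n) {x y : ℚ} (hx : 0 < x) (hy : 0 < y) :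
    risingFactorial (x + y) (2 * c * (n - 1)) ^ n * selbergValue n c x y =
      ∏ k ∈ Finset.range (n - 1),
        ((((k + 2) * c).factorial / c.factorial : ℕ) : ℚ) *
          risingFactorial x ((k + 1) * c) * risingFactorial y ((k + 1) * c) *
          risingFactorial (x + y + (((2 * n - (k + 1) - 2) * c : ℕ) : ℚ)) ((k + 1) * c) := by
  obtain ⟨n, rfl⟩ : ∃ m, n = m + 1 := ⟨n - 1, by omega⟩
  have hdiv : ∀ k, ((((k + 2) * c).factorial / c.factorial : ℕ) : ℚ) =
      ((k + 2) * c).factorial / c.factorial := fun k =>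
    Nat.cast_div (Nat.factorial_dvd_factorial (Nat.le_mul_of_pos_left c (by omega)))
      (by positivity)
  have h3 : risingFactorial (x + y) (2 * c * n) ^ (n + 1) =
      ∏ k ∈ Finset.range (n + 1), risingFactorial (x + y) (2 * c * n) := by simp
  have h4 : (∏ k ∈ Finset.range (n + 1), risingFactorial (x + y) (2 * c * n)) /
      ∏ k ∈ Finset.range (n + 1), risingFactorial (x + y) ((n + k) * c) =
      ∏ k ∈ Finset.range n,
        risingFactorial (x + y + (((2 * (n + 1) - (k + 1) - 2) * c : ℕ) : ℚ)) ((k + 1) * c) := by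
    rw [← Finset.prod_div_distrib, ← Finset.prod_range_reflect, Finset.prod_range_succ']
    have h0 := (risingFactorial_pos (add_pos hx hy) (2 * c * n)).ne'
    have e0 : (n + (n + 1 - 1 - 0)) * c = 2 * c * n := by
      simp only [Nat.add_sub_cancel, Nat.sub_zero]; ring
    rw [e0, div_self h0, mul_one]
    refine Finset.prod_congr rfl fun k hk => ?_
    have hk' := Finset.mem_range.1 hk
    have e := risingFactorial_add (x + y) ((2 * (n + 1) - (k + 1) - 2) * c) ((k + 1) * c)
    rw [← add_mul, show 2 * (n + 1) - (k + 1) - 2 + (k + 1) = 2 * n by omega] at e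
    rw [show n + (n + 1 - 1 - (k + 1)) = 2 * (n + 1) - (k + 1) - 2 by omega,
      mul_right_comm 2 c n, e, mul_div_cancel_left₀]
    exact (risingFactorial_pos (add_pos hx hy) _).ne'
  have e4 : ∏ j ∈ Finset.range (n + 1), (((j + 1) * c).factorial : ℚ) =
      (∏ j ∈ Finset.range n, (((j + 2) * c).factorial : ℚ)) * c.factorial := by
    rw [Finset.prod_range_succ', zero_add, one_mul]
  simp only [Nat.add_sub_cancel, hdiv, Finset.prod_mul_distrib, ← h4]
  rw [h3, selbergValue]
  simp only [Nat.add_sub_cancel, Finset.prod_mul_distrib, Finset.prod_div_distrib]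
  rw [Finset.prod_range_succ' (fun j => risingFactorial x (j * c)),
    Finset.prod_range_succ' (fun j => risingFactorial y (j * c)),
    e4, Finset.prod_range_succ (fun j => (c.factorial : ℚ))]
  have f0 : (c.factorial : ℚ) ≠ 0 := by positivity
  have p3 : ∏ j ∈ Finset.range n, (c.factorial : ℚ) ≠ 0 :=
    Finset.prod_ne_zero_iff.2 fun j _ => f0
  simp only [zero_mul, risingFactorial_zero, mul_one]
  field_simp

/-- The remarkable combinatorial identity in `ℤ[x,y]` (with `x = X 0`, `y = X 1`). -/
theorem combinatorial_identity (n c : ℕ) (hn : 2 ≤ n) (hc : 1 ≤ c) :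
    (∑ m : {q : Fin n × Fin n // q.1 < q.2} → Fin (2 * c + 1),
      ((-1 : MvPolynomial (Fin 2) ℤ) ^ (∑ q, (m q : ℕ)) *
        (∏ q, (Nat.choose (2 * c) (m q) : MvPolynomial (Fin 2) ℤ)) *
        ∏ k : Fin n, risingFactorial (X 0) (rVal n c m k) *
          risingFactorial (X 1) (sVal n c m k))) =
      ∏ k ∈ Finset.range (n - 1),
        ((((k + 2) * c).factorial / c.factorial : ℕ) : MvPolynomial (Fin 2) ℤ) *
          risingFactorial (X 0) ((k + 1) * c) * risingFactorial (X 1) ((k + 1) * c) *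
          risingFactorial (X 0 + X 1 + (((2 * n - (k + 1) - 2) * c : ℕ) : MvPolynomial (Fin 2) ℤ)) ((k + 1) * c) := by

  have hs : (Set.range fun k : ℕ => (1 + k : ℤ)).Infinite :=
    Set.infinite_range_of_injective fun a b h => by simpa using h
  refine MvPolynomial.funext_set (fun _ => Set.range fun k : ℕ => (1 + k : ℤ)) (fun _ => hs)
    fun v hv => ?_
  obtain ⟨a, ha⟩ := hv 0 trivial
  obtain ⟨b, hb⟩ := hv 1 trivial
  have hx : (0 : ℚ) < 1 + a := by positivity
  have hy : (0 : ℚ) < 1 + b := by positivity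
  have h := sum_eq_betaExp hx hy n c
  rw [betaExp_diffProd_eq_selbergValue hc hy, selbergValue_eq hn hx hy] at h
  have hx' : (Int.castRingHom ℚ) (v 0) = 1 + a := by rw [← ha]; simp
  have hy' : (Int.castRingHom ℚ) (v 1) = 1 + b := by rw [← hb]; simp
  apply (Int.cast_injective : Function.Injective (Int.cast : ℤ → ℚ))
  change Int.castRingHom ℚ _ = Int.castRingHom ℚ _
  simp only [map_sum, map_prod, map_mul, map_pow, map_neg, map_one, map_natCast, map_add,
    map_risingFactorial, eval_X, hx', hy']
  exact h
end

section
/- Let p be an odd prime, n ≥ 1, c ≥ 1, and a, b, i nonnegative integers with 1 ≤ i ≤ n-1, a ≤ p-1-(n-1)c, and p-1-(n-i)c+1 ≤ b ≤ p-1-(n-i-1)c. Then the F_p-Selberg integral factorizes: S_n(a,b,c) = (-1)^((n-i)ic) C(nc, ic) · [∏_{j=1}^{n-i} C(p-1-(n-j)c-a, (j-1)c) · ∏_{j=1}^{i} C(p-1-(n-j)c-a, (j-1)c) / ∏_{j=1}^{n} C(p-1-(n-j)c-a, (j-1)c)] · S_{n-i}(a+ic, b, c) · S_i(a+(n-i)c,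 b+(n-i)c-p, c) in F_p. -/
open MvPolynomial Finset

/-- The Selberg master polynomial `∏_{i<j}(x_i-x_j)^{2c} ∏_i x_i^a (1-x_i)^b` over `F_p`. -/
noncomputable def selbergPoly (p n a b c : ℕ) : MvPolynomial (Fin n) (ZMod p) :=
  (∏ i : Fin n, ∏ j ∈ Finset.univ.filter (fun j => i < j), (X i - X j) ^ (2 * c)) *
    ∏ i : Fin n, X i ^ a * (1 - X i) ^ b

/-- The `F_p`-Selberg integral `S_n(a,b,c)`: the coefficient of
`x_1^(p-1) ⋯ x_n^(p-1)` in the Selberg master polynomial. -/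
noncomputable def selbergInt (p n a b c : ℕ) : ZMod p :=
  MvPolynomial.coeff (Finsupp.equivFunOnFinite.symm fun _ : Fin n => p - 1)
    (selbergPoly p n a b c)

/-- The even power `∏_{i<j} (x_i-x_j)^{2c}` of the Vandermonde product, over `ℤ`. -/
noncomputable def vandermondePow (n c : ℕ) : MvPolynomial (Fin n) ℤ :=
  ∏ i : Fin n, ∏ j ∈ Finset.univ.filter (fun j => i < j), (X i - X j) ^ (2 * c)

/-- The polynomial `∏_{i<j} (x_i-x_j)^{2c} ∏_i (1-x_i)^b` over `ℤ`. -/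
noncomputable def morrisPoly (n b c : ℕ) : MvPolynomial (Fin n) ℤ :=
  vandermondePow n c * ∏ i : Fin n, (1 - X i) ^ b

/-- The exponent vector with all entries equal to `A`. -/
noncomputable def constExp (n A : ℕ) : Fin n →₀ ℕ :=
  Finsupp.equivFunOnFinite.symm fun _ => A

/-- The coefficient of `(x_1 ⋯ x_n)^A` in `∏_{i<j} (x_i-x_j)^{2c} ∏_i (1-x_i)^b`. -/
noncomputable def morrisCoeff (n A b c : ℕ) : ℤ :=
  coeff (constExp n A) (morrisPoly n b c)

@[simp]
theorem constExp_apply (n A : ℕ) (i : Fin n) : constExp n A i = A := rfl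

theorem degree_constExp (n A : ℕ) : (constExp n A).degree = n * A := by
  simp [Finsupp.degree_eq_sum]

theorem vandermondePow_succ (n c : ℕ) :
    vandermondePow (n + 1) c =
      (∏ j : Fin n, (X 0 - X j.succ) ^ (2 * c)) * rename Fin.succ (vandermondePow n c) := by
  simp [vandermondePow, Finset.prod_filter, Fin.prod_univ_succ, map_prod, apply_ite]

theorem isHomogeneous_vandermondePow (n c : ℕ) :
    (vandermondePow n c).IsHomogeneous (n * ((n - 1) * c)) := by
  induction n with
  | zero => simpa [vandermondePow] using isHomogeneous_one (Fin 0) ℤ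
  | succ n ih =>
    rw [vandermondePow_succ]
    have h1 : (∏ j : Fin n, (X 0 - X j.succ : MvPolynomial (Fin (n + 1)) ℤ) ^ (2 * c)).IsHomogeneous
        (∑ _j : Fin n, 1 * (2 * c)) :=
      IsHomogeneous.prod _ _ _ fun j _ => ((isHomogeneous_X _ _).sub (isHomogeneous_X _ _)).pow _
    convert h1.mul (ih.rename_isHomogeneous (f := Fin.succ)) using 1
    rcases n with _ | n
    · simp
    · simp; ring

theorem rename_perm_vandermondePow {n : ℕ} (c : ℕ) (σ : Equiv.Perm (Fin n)) :
    rename σ (vandermondePow n c) = vandermondePow n c := by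
  have h : vandermondePow n c =
      (Matrix.vandermonde (X : Fin n → MvPolynomial (Fin n) ℤ)).det ^ (2 * c) := by
    rw [Matrix.det_vandermonde, ← Finset.prod_pow]
    refine Finset.prod_congr rfl fun i _ => ?_
    rw [← Finset.prod_pow]
    refine Finset.prod_congr (by ext; simp) fun j _ => ?_
    rw [pow_mul, pow_mul, sub_sq_comm]
  have h2 : (rename σ : MvPolynomial (Fin n) ℤ →ₐ[ℤ] _).toRingHom.mapMatrix
      (Matrix.vandermonde (X : Fin n → MvPolynomial (Fin n) ℤ)) =
      (Matrix.vandermonde (X : Fin n → MvPolynomial (Fin n) ℤ)).submatrix σ id := by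
    ext i j
    simp [Matrix.vandermonde]
  have h3 := RingHom.map_det (rename σ : MvPolynomial (Fin n) ℤ →ₐ[ℤ] _).toRingHom
    (Matrix.vandermonde (X : Fin n → MvPolynomial (Fin n) ℤ))
  rw [h2, Matrix.det_permute] at h3
  rw [h, map_pow]
  change ((rename σ : MvPolynomial (Fin n) ℤ →ₐ[ℤ] _).toRingHom _) ^ _ = _
  rw [h3, mul_pow, pow_mul, ← Int.cast_pow]
  simp [← Units.val_pow_eq_pow_val]

theorem rename_perm_morrisPoly {n : ℕ} (b c : ℕ) (σ : Equiv.Perm (Fin n)) :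
    rename σ (morrisPoly n b c) = morrisPoly n b c := by
  rw [morrisPoly, map_mul, rename_perm_vandermondePow, map_prod]
  congr 1
  simp only [map_pow, map_sub, map_one, rename_X]
  exact Equiv.prod_comp σ fun i => (1 - X i : MvPolynomial (Fin n) ℤ) ^ b

theorem coeff_constExp_rename {n : ℕ} (A : ℕ) (σ : Equiv.Perm (Fin n))
    (f : MvPolynomial (Fin n) ℤ) :
    coeff (constExp n A) (rename σ f) = coeff (constExp n A) f := by
  have h : (constExp n A).mapDomain σ = constExp n A := by
    ext i
    simp [Finsupp.mapDomain_equiv_apply]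
  conv_lhs => rw [← h]
  exact coeff_rename_mapDomain _ σ.injective _ _

theorem coeff_prod_X_mul_eq_of_card {n : ℕ} (A b c : ℕ) {s t : Finset (Fin n)}
    (h : s.card = t.card) :
    coeff (constExp n A) ((∏ i ∈ s, X i) * morrisPoly n b c) =
      coeff (constExp n A) ((∏ i ∈ t, X i) * morrisPoly n b c) := by
  obtain ⟨σ, hσ⟩ : ∃ σ : Equiv.Perm (Fin n), s.map σ.toEmbedding = t := by
    obtain ⟨e⟩ := Fintype.card_eq.mp (show Fintype.card s = Fintype.card t by simpa using h)
    refine ⟨e.extendSubtype, ?_⟩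
    refine Finset.eq_of_subset_of_card_le (fun x hx => ?_) (by simp [h])
    obtain ⟨y, hy, rfl⟩ := Finset.mem_map.mp hx
    exact e.extendSubtype_mem y hy
  rw [← coeff_constExp_rename A σ, map_mul, rename_perm_morrisPoly, ← hσ]
  simp [map_prod]

theorem Derivation.map_prod_eq_sum {R A ι : Type*} [CommRing R] [CommRing A] [Algebra R A]
    [DecidableEq ι] (D : Derivation R A A) (s : Finset ι) (f : ι → A) :
    D (∏ i ∈ s, f i) = ∑ i ∈ s, (∏ j ∈ s.erase i, f j) * D (f i) := by
  induction s using Finset.induction_on with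
  | empty => simp
  | insert a s ha ih =>
    rw [Finset.prod_insert ha, D.leibniz, ih, Finset.sum_insert ha, Finset.erase_insert ha,
      smul_eq_mul, smul_eq_mul, Finset.mul_sum, add_comm]
    congr 1
    refine Finset.sum_congr rfl fun i hi => ?_
    rw [Finset.erase_insert_of_ne (by rintro rfl; exact ha hi),
      Finset.prod_insert (fun h => ha (Finset.mem_of_mem_erase h)), mul_assoc]

theorem pderiv_zero_rename_succ {n : ℕ} (f : MvPolynomial (Fin n) ℤ) :
    pderiv 0 (rename Fin.succ f) = 0 := by
  induction f using MvPolynomial.induction_on with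
  | C a => simp
  | add p q hp hq => simp [hp, hq]
  | mul_X p i hp => simp [hp, pderiv_X_of_ne (Fin.succ_ne_zero i)]

/-- The logarithmic derivative of `morrisPoly` in the variable `x_0`, in terms of the quotients
`Ψ j` of `morrisPoly` by `x_0 - x_j`. -/
theorem exists_cofactors_morrisPoly (n b : ℕ) {c : ℕ} (hc : 1 ≤ c) :
    ∃ Ψ : Fin n → MvPolynomial (Fin (n + 1)) ℤ,
      (∀ j, (X 0 - X j.succ) * Ψ j = morrisPoly (n + 1) b c) ∧
      (1 - X 0) * pderiv 0 (morrisPoly (n + 1) b c) =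
        2 * (c : MvPolynomial (Fin (n + 1)) ℤ) * ∑ j, (1 - X 0) * Ψ j -
          (b : MvPolynomial (Fin (n + 1)) ℤ) * morrisPoly (n + 1) b c := by
  set R : MvPolynomial (Fin (n + 1)) ℤ :=
    rename Fin.succ (vandermondePow n c * ∏ i : Fin n, (1 - X i) ^ b) with hR
  set f : Fin n → MvPolynomial (Fin (n + 1)) ℤ := fun j => X 0 - X j.succ with hf
  have hK : morrisPoly (n + 1) b c = (∏ j, f j ^ (2 * c)) * ((1 - X 0) ^ b * R) := by
    rw [morrisPoly, vandermondePow_succ, Fin.prod_univ_succ, hR]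
    simp only [map_mul, map_prod, map_pow, map_sub, map_one, rename_X, hf]
    ring
  have hfd : ∀ j, pderiv 0 (f j) = 1 := fun j => by
    simp [hf, pderiv_X_of_ne (Fin.succ_ne_zero j)]
  refine ⟨fun j => (∏ k ∈ univ.erase j, f k ^ (2 * c)) * f j ^ (2 * c - 1) *
    ((1 - X 0) ^ b * R), fun j => ?_, ?_⟩
  · rw [hK, ← Finset.mul_prod_erase univ _ (Finset.mem_univ j)]
    have : f j ^ (2 * c) = f j * f j ^ (2 * c - 1) := by
      rw [← pow_succ']; congr 1; omega
    rw [this]; ring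
  · have hb : (1 - X 0) * pderiv 0 ((1 - X 0 : MvPolynomial (Fin (n + 1)) ℤ) ^ b) =
        -(b : MvPolynomial (Fin (n + 1)) ℤ) * (1 - X 0) ^ b := by
      rcases b with _ | b
      · simp
      · rw [pderiv_pow]
        simp
        ring
    have hP : pderiv 0 (∏ j, f j ^ (2 * c)) = 2 * (c : MvPolynomial (Fin (n + 1)) ℤ) *
        ∑ j, (∏ k ∈ univ.erase j, f k ^ (2 * c)) * f j ^ (2 * c - 1) := by
      rw [Derivation.map_prod_eq_sum, Finset.mul_sum]
      refine Finset.sum_congr rfl fun j _ => ?_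
      rw [pderiv_pow, hfd]
      push_cast
      ring
    rw [← Finset.mul_sum, ← Finset.sum_mul, hK, pderiv_mul, pderiv_mul, hP,
      show pderiv 0 R = 0 from pderiv_zero_rename_succ _]
    linear_combination (∏ j, f j ^ (2 * c)) * R * hb

theorem coeff_X_mul_pderiv {n : ℕ} (i : Fin n) (f : MvPolynomial (Fin n) ℤ) (m : Fin n →₀ ℕ) :
    coeff m (X i * pderiv i f) = m i * coeff m f := by
  induction f using MvPolynomial.induction_on' with
  | monomial u a =>
    rw [X_mul_pderiv_monomial, coeff_smul, nsmul_eq_mul]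
    by_cases h : u = m
    · simp [h]
    · simp [coeff_monomial, h]
  | add p q hp hq => simp [hp, hq, mul_add]

/-- Antisymmetrization in `x_i` and `x_j` of a coefficient of `g` times the quotient `Ψ` of
`morrisPoly` by `x_i - x_j`. -/
theorem two_mul_coeff_mul_cofactor {n : ℕ} (A b c : ℕ) {i j : Fin n} (hij : i ≠ j)
    {Ψ g h : MvPolynomial (Fin n) ℤ} (hΨ : (X i - X j) * Ψ = morrisPoly n b c)
    (hg : g - rename (Equiv.swap i j) g = (X i - X j) * h) :
    2 * coeff (constExp n A) (g * Ψ) = coeff (constExp n A) (h * morrisPoly n b c) := by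
  have hX : (X i - X j : MvPolynomial (Fin n) ℤ) ≠ 0 :=
    sub_ne_zero.mpr fun h => hij (X_injective h)
  have hσ : rename (Equiv.swap i j) Ψ = -Ψ := by
    have h1 := congrArg (rename (Equiv.swap i j)) hΨ
    rw [rename_perm_morrisPoly, ← hΨ, map_mul, map_sub, rename_X, rename_X,
      Equiv.swap_apply_left, Equiv.swap_apply_right] at h1
    apply mul_left_cancel₀ hX
    linear_combination -h1
  have h2 := coeff_constExp_rename A (Equiv.swap i j) (g * Ψ)
  rw [map_mul, hσ] at h2
  have h3 : h * morrisPoly n b c = g * Ψ + rename (Equiv.swap i j) g * -Ψ := by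
    rw [← hΨ]
    linear_combination -Ψ * hg
  rw [h3, coeff_add, h2, two_mul]

/-- Aomoto's relation. -/
theorem coeff_insert_zero_prod_X_mul (n A b : ℕ) {c : ℕ} (hc : 1 ≤ c) {s : Finset (Fin (n + 1))}
    (hs : 0 ∉ s) :
    ((A : ℤ) - (n - s.card) * c) *
        coeff (constExp (n + 1) A) ((∏ i ∈ s, X i) * morrisPoly (n + 1) b c) =
      (A - b - 1 - s.card * c - 2 * (n - s.card) * c) *
        coeff (constExp (n + 1) A) ((∏ i ∈ insert 0 s, X i) * morrisPoly (n + 1) b c) := by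
  obtain ⟨Ψ, hΨ, hd⟩ := exists_cofactors_morrisPoly n b hc
  set K := morrisPoly (n + 1) b c with hK
  set M : MvPolynomial (Fin (n + 1)) ℤ := ∏ i ∈ s, X i with hM
  set e := constExp (n + 1) A with he
  have hins : ∏ i ∈ insert 0 s, (X i : MvPolynomial (Fin (n + 1)) ℤ) = X 0 * M :=
    Finset.prod_insert hs
  rw [hins]
  have hM0 : pderiv 0 M = 0 := by
    rw [hM, Derivation.map_prod_eq_sum]
    refine Finset.sum_eq_zero fun i hi => ?_
    rw [pderiv_X_of_ne (by rintro rfl; exact hs hi), mul_zero]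
  have hpair : ∀ j : Fin n, 2 * coeff e (X 0 * (1 - X 0) * M * Ψ j) =
      (if j.succ ∈ s then 0 else coeff e (M * K)) -
        (if j.succ ∈ s then 1 else 2) * coeff e (X 0 * M * K) := by
    intro j
    have hne : (0 : Fin (n + 1)) ≠ j.succ := (Fin.succ_ne_zero j).symm
    have hfix : ∀ t : Finset (Fin (n + 1)), 0 ∉ t → j.succ ∉ t →
        rename (Equiv.swap 0 j.succ) (∏ i ∈ t, X i : MvPolynomial (Fin (n + 1)) ℤ) =
          ∏ i ∈ t, X i := by
      intro t h0 hj
      rw [map_prod]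
      refine Finset.prod_congr rfl fun i hi => ?_
      rw [rename_X, Equiv.swap_apply_of_ne_of_ne (by rintro rfl; exact h0 hi)
        (by rintro rfl; exact hj hi)]
    by_cases hj : j.succ ∈ s
    · have hMj : M = X j.succ * ∏ i ∈ s.erase j.succ, X i := (Finset.mul_prod_erase s _ hj).symm
      have := hfix (s.erase j.succ) (fun h => hs (Finset.mem_of_mem_erase h))
        (Finset.notMem_erase _ _)
      rw [two_mul_coeff_mul_cofactor A b c hne (hΨ j) (h := -(X 0 * M))]
      · simp [hj, he, hK]
      · simp only [map_mul, map_sub, map_one, rename_X, Equiv.swap_apply_left,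
          Equiv.swap_apply_right, hMj, this]
        ring
    · have hcard : coeff e (X j.succ * M * K) = coeff e (X 0 * M * K) := by
        rw [← hins, hM, ← Finset.prod_insert hj]
        refine coeff_prod_X_mul_eq_of_card A b c ?_
        rw [Finset.card_insert_of_notMem hj, Finset.card_insert_of_notMem hs]
      rw [two_mul_coeff_mul_cofactor A b c hne (hΨ j) (h := (1 - X 0 - X j.succ) * M)]
      · simp only [hj, if_false, sub_mul, one_mul, coeff_sub, ← hK, ← he, hcard]
        ring
      · simp only [map_mul, map_sub, map_one, rename_X, Equiv.swap_apply_left, hM,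
          hfix s hs hj]
        ring
  have hcount : (∑ j : Fin n, if j.succ ∈ s then (1 : ℤ) else 0) = s.card := by
    rw [Finset.sum_boole]
    congr 1
    rw [← Finset.card_map (Fin.succEmb n)]
    congr 1
    ext i
    refine Fin.cases ?_ (fun k => ?_) i <;> simp [hs]
  have hsum : 2 * coeff e (∑ j, X 0 * (1 - X 0) * M * Ψ j) =
      (n - s.card) * coeff e (M * K) - (2 * n - s.card) * coeff e (X 0 * M * K) := by
    rw [coeff_sum, Finset.mul_sum, Finset.sum_congr rfl fun j _ => hpair j, ← hcount]
    have : ∀ j : Fin n, ((if j.succ ∈ s then 0 else coeff e (M * K)) -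
        (if j.succ ∈ s then 1 else 2) * coeff e (X 0 * M * K)) =
        (1 - if j.succ ∈ s then (1 : ℤ) else 0) * coeff e (M * K) -
          (2 - if j.succ ∈ s then (1 : ℤ) else 0) * coeff e (X 0 * M * K) := by
      intro j; split_ifs <;> ring
    rw [Finset.sum_congr rfl fun j _ => this j, Finset.sum_sub_distrib, ← Finset.sum_mul,
      ← Finset.sum_mul, Finset.sum_sub_distrib, Finset.sum_sub_distrib]
    simp [mul_comm]
  have heuler := coeff_X_mul_pderiv 0 ((1 - X 0) * (M * K)) e
  have hder : X 0 * pderiv 0 ((1 - X 0) * (M * K)) =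
      C (c : ℤ) * (C 2 * ∑ j, X 0 * (1 - X 0) * M * Ψ j) - C (b + 1 : ℤ) * (X 0 * M * K) := by
    have hS : ∑ j, X 0 * (1 - X 0) * M * Ψ j = X 0 * M * ∑ j, (1 - X 0) * Ψ j := by
      rw [Finset.mul_sum]
      exact Finset.sum_congr rfl fun j _ => by ring
    rw [hS, pderiv_mul, pderiv_mul, hM0, map_sub, pderiv_one, pderiv_X_self]
    simp only [map_add, map_natCast, map_one, map_ofNat]
    linear_combination X 0 * M * hd
  have hexp : (1 - X 0) * (M * K) = M * K - X 0 * M * K := by ring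
  rw [hder, hexp, coeff_sub, coeff_sub, coeff_C_mul, coeff_C_mul, coeff_C_mul, hsum, he,
    constExp_apply, ← he] at heuler
  linear_combination -heuler

theorem coeff_prod_X_mul_morrisPoly (n A b c : ℕ) :
    coeff (constExp n (A + 1)) ((∏ i : Fin n, X i) * morrisPoly n b c) = morrisCoeff n A b c := by
  have h : (∏ i : Fin n, X i : MvPolynomial (Fin n) ℤ) = monomial (constExp n 1) 1 := by
    rw [monomial_eq, C_1, one_mul, Finsupp.prod_fintype _ _ (by simp)]
    simp
  have h2 : constExp n (A + 1) = constExp n 1 + constExp n A := by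
    ext; simp [add_comm]
  rw [h, h2, coeff_monomial_mul, one_mul, morrisCoeff]

theorem morrisCoeff_zero (A b c : ℕ) : morrisCoeff 0 A b c = 1 := by
  simp [morrisCoeff, morrisPoly, vandermondePow, Subsingleton.elim (constExp 0 _) 0]

/-- The recursion in `β` for the coefficient of `(x_1 ⋯ x_n)^(β + (n-1)c)`. -/
theorem morrisCoeff_succ_mul (n β b : ℕ) {c : ℕ} (hc : 1 ≤ c) :
    morrisCoeff n (β + 1 + (n - 1) * c) b c * ∏ j ∈ range n, ((β : ℤ) + 1 + j * c) =
      (-1) ^ n * morrisCoeff n (β + (n - 1) * c) b c *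
        ∏ j ∈ range n, ((b : ℤ) - β + j * c) := by
  rcases n with _ | n
  · simp [morrisCoeff_zero]
  set A := β + 1 + n * c with hA
  obtain ⟨u, hu⟩ : ∃ u : ℕ → ℤ, ∀ s : Finset (Fin (n + 1)),
      coeff (constExp (n + 1) A) ((∏ i ∈ s, X i) * morrisPoly (n + 1) b c) = u s.card := by
    classical
    refine ⟨fun k => if h : ∃ s : Finset (Fin (n + 1)), s.card = k then
      coeff (constExp (n + 1) A) ((∏ i ∈ h.choose, X i) * morrisPoly (n + 1) b c) else 0,
      fun s => ?_⟩
    have h : ∃ t : Finset (Fin (n + 1)), t.card = s.card := ⟨s, rfl⟩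
    simp only [dif_pos h]
    exact coeff_prod_X_mul_eq_of_card A b c h.choose_spec.symm
  have hstep : ∀ r ≤ n, ((β : ℤ) + 1 + r * c) * u r = -(b - β + (n - r) * c) * u (r + 1) := by
    intro r hr
    obtain ⟨s, hs, hcard⟩ := Finset.exists_subset_card_eq
      (s := univ.map (Fin.succEmb n)) (n := r) (by simpa using hr)
    have h0 : (0 : Fin (n + 1)) ∉ s := fun h => by simpa using hs h
    have := coeff_insert_zero_prod_X_mul n A b hc h0
    rw [hu, hu, Finset.card_insert_of_notMem h0, hcard, hA] at this
    push_cast at this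
    linear_combination this
  have hprod : ∀ r ≤ n + 1, (∏ j ∈ range r, ((β : ℤ) + 1 + j * c)) * u 0 =
      (-1) ^ r * (∏ j ∈ range r, ((b : ℤ) - β + (n - j) * c)) * u r := by
    intro r
    induction r with
    | zero => simp
    | succ r ih =>
      intro hr
      rw [Finset.prod_range_succ, Finset.prod_range_succ]
      linear_combination (β + 1 + r * c : ℤ) * ih (by omega) +
        (-1) ^ r * (∏ j ∈ range r, ((b : ℤ) - β + (n - j) * c)) * hstep r (by omega)
  have hrefl : ∏ j ∈ range (n + 1), ((b : ℤ) - β + (n - j) * c) =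
      ∏ j ∈ range (n + 1), ((b : ℤ) - β + j * c) := by
    rw [← Finset.prod_range_reflect]
    refine Finset.prod_congr rfl fun j hj => ?_
    rw [Finset.mem_range] at hj
    rw [show n + 1 - 1 - j = n - j by omega, Nat.cast_sub (by omega)]
    ring
  have h0 : u 0 = morrisCoeff (n + 1) A b c := by
    simpa [morrisCoeff] using (hu ∅).symm
  have hn : u (n + 1) = morrisCoeff (n + 1) (β + n * c) b c := by
    have := hu univ
    rw [hA, show β + 1 + n * c = β + n * c + 1 by ring, coeff_prod_X_mul_morrisPoly] at this
    simpa using this.symm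
  have := hprod (n + 1) le_rfl
  rw [hrefl, h0, hn] at this
  rw [Nat.add_sub_cancel, ← hA]
  linear_combination this

theorem coeff_mul_of_isHomogeneous {σ R : Type*} [CommRing R] {d : ℕ} {P : MvPolynomial σ R}
    (hP : P.IsHomogeneous d) (Q : MvPolynomial σ R) {e : σ →₀ ℕ} (he : e.degree = d) :
    coeff e (P * Q) = coeff e P * constantCoeff Q := by
  classical
  rw [coeff_mul, Finset.sum_eq_single (e, 0), constantCoeff_eq]
  · rintro ⟨x, y⟩ hxy hne
    rw [HasAntidiagonal.mem_antidiagonal] at hxy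
    simp only at hxy ⊢
    rw [hP.coeff_eq_zero, zero_mul]
    intro hx
    have : y.degree = 0 := by
      rw [← hxy, Finsupp.degree.map_add] at he
      omega
    rw [Finsupp.degree_eq_zero_iff] at this
    subst this
    exact hne (by simpa using hxy)
  · intro h
    simp at h

theorem coeff_mul_eq_zero_of_isHomogeneous {σ R : Type*} [CommRing R] {d : ℕ}
    {P : MvPolynomial σ R} (hP : P.IsHomogeneous d) (Q : MvPolynomial σ R) {e : σ →₀ ℕ}
    (he : e.degree < d) : coeff e (P * Q) = 0 := by
  classical
  rw [coeff_mul]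
  refine Finset.sum_eq_zero fun x hx => ?_
  rw [HasAntidiagonal.mem_antidiagonal] at hx
  rw [hP.coeff_eq_zero, zero_mul]
  rw [← hx, Finsupp.degree.map_add] at he
  omega

/-- Setting `x_0 = 1` in a homogeneous polynomial does not lose any coefficient. -/
theorem coeff_eval_one_finSuccEquiv {R : Type*} [CommRing R] {n d k : ℕ}
    {P : MvPolynomial (Fin (n + 1)) R} (hP : P.IsHomogeneous d) {e : Fin n →₀ ℕ}
    (he : k + e.degree = d) :
    coeff e ((finSuccEquiv R n P).eval 1) = coeff (e.cons k) P := by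
  rw [Polynomial.eval_eq_sum_range, coeff_sum, Finset.sum_eq_single k]
  · rw [one_pow, mul_one, finSuccEquiv_coeff_coeff]
  · intro m _ hm
    rw [one_pow, mul_one, finSuccEquiv_coeff_coeff, hP.coeff_eq_zero]
    have : (e.cons m).degree = m + e.degree := by
      simp [Finsupp.degree_eq_sum, Fin.sum_univ_succ]
    omega
  · intro hk
    rw [Finset.mem_range, not_lt, Nat.succ_le_iff] at hk
    rw [Polynomial.coeff_eq_zero_of_natDegree_lt hk]
    simp

theorem morrisCoeff_base (n b c : ℕ) :
    morrisCoeff n ((n - 1) * c) b c = coeff (constExp n ((n - 1) * c)) (vandermondePow n c) := by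
  rw [morrisCoeff, morrisPoly, coeff_mul_of_isHomogeneous (isHomogeneous_vandermondePow n c) _
    (degree_constExp _ _)]
  simp [map_prod]

theorem finSuccEquiv_rename_succ {R : Type*} [CommRing R] {n : ℕ} (f : MvPolynomial (Fin n) R) :
    finSuccEquiv R n (rename Fin.succ f) = Polynomial.C f := by
  induction f using MvPolynomial.induction_on with
  | C a => simp [finSuccEquiv_apply]
  | add p q hp hq => simp [hp, hq]
  | mul_X p i hp => simp [hp, finSuccEquiv_X_succ]

theorem morrisCoeff_base_succ (n b c : ℕ) :
    morrisCoeff (n + 1) (n * c) b c = morrisCoeff n (n * c) (2 * c) c := by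
  have h := morrisCoeff_base (n + 1) b c
  rw [Nat.add_sub_cancel] at h
  have hcons : constExp (n + 1) (n * c) = (constExp n (n * c)).cons (n * c) := by
    ext i
    refine Fin.cases ?_ (fun j => ?_) i <;> simp
  rw [h, hcons, ← coeff_eval_one_finSuccEquiv (isHomogeneous_vandermondePow (n + 1) c)
    (by rw [degree_constExp, Nat.add_sub_cancel]; ring), morrisCoeff, vandermondePow_succ,
    map_mul, finSuccEquiv_rename_succ, morrisPoly, mul_comm (vandermondePow n c)]
  simp [Polynomial.eval_prod, map_prod, finSuccEquiv_X_zero, finSuccEquiv_X_succ]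

theorem cast_choose_succ_mul (m k : ℕ) :
    ((m.choose (k + 1) : ℕ) : ℤ) * (k + 1) = m.choose k * (m - k) := by
  rcases le_or_gt k m with h | h
  · rw [← Nat.cast_sub h]
    exact_mod_cast Nat.choose_succ_right_eq m k
  · simp [Nat.choose_eq_zero_of_lt h, Nat.choose_eq_zero_of_lt (Nat.lt_succ_of_lt h)]

theorem cast_add_choose_mul (β m : ℕ) :
    (((β + 1 + m).choose m : ℕ) : ℤ) * (β + 1) = (β + m).choose m * (β + 1 + m) := by
  rw [Nat.choose_symm_add.symm, show (β + m).choose m = (β + m).choose β from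
    Nat.choose_symm_add.symm, show β + 1 + m = β + m + 1 by ring]
  have := Nat.add_one_mul_choose_eq (β + m) β
  zify at this
  linear_combination -this

/-- The Morris identity for all `β` follows from the case `β = 0`. -/
theorem morris_identity_of_base {n c : ℕ} (hc : 1 ≤ c)
    (h : ∀ b, morrisCoeff n ((n - 1) * c) b c * (c.factorial : ℤ) ^ n =
      (-1) ^ (c * n.choose 2) * (n * c).factorial) (β b : ℕ) :
    morrisCoeff n (β + (n - 1) * c) b c * (∏ j ∈ range n, ((β + j * c).choose (j * c) : ℤ)) *
        (c.factorial : ℤ) ^ n =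
      (-1) ^ (n * β + c * n.choose 2) * (n * c).factorial *
        ∏ j ∈ range n, ((b + j * c).choose β : ℤ) := by
  induction β with
  | zero => simpa using h b
  | succ β ih =>
    have hβ : ((β : ℤ) + 1) ^ n ≠ 0 := by positivity
    have hpow : ((β : ℤ) + 1) ^ n = ∏ _j ∈ range n, ((β : ℤ) + 1) := by simp
    have h1 : (∏ j ∈ range n, ((β + 1 + j * c).choose (j * c) : ℤ)) * ((β : ℤ) + 1) ^ n =
        (∏ j ∈ range n, ((β + j * c).choose (j * c) : ℤ)) *
          ∏ j ∈ range n, ((β : ℤ) + 1 + j * c) := by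
      rw [hpow, ← Finset.prod_mul_distrib, ← Finset.prod_mul_distrib]
      refine Finset.prod_congr rfl fun j _ => ?_
      have := cast_add_choose_mul β (j * c)
      push_cast at this
      exact this
    have h2 : (∏ j ∈ range n, ((b + j * c).choose (β + 1) : ℤ)) * ((β : ℤ) + 1) ^ n =
        (∏ j ∈ range n, ((b + j * c).choose β : ℤ)) *
          ∏ j ∈ range n, ((b : ℤ) - β + j * c) := by
      rw [hpow, ← Finset.prod_mul_distrib, ← Finset.prod_mul_distrib]
      refine Finset.prod_congr rfl fun j _ => ?_
      have := cast_choose_succ_mul (b + j * c) β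
      push_cast at this
      linear_combination this
    have h3 := morrisCoeff_succ_mul n β b hc
    refine mul_right_cancel₀ hβ ?_
    have hs : (-1 : ℤ) ^ (n * (β + 1) + c * n.choose 2) =
        (-1) ^ n * (-1) ^ (n * β + c * n.choose 2) := by
      rw [← pow_add]; congr 1; ring
    rw [hs]
    linear_combination morrisCoeff n (β + 1 + (n - 1) * c) b c * (c.factorial : ℤ) ^ n * h1 -
      (-1) ^ n * (-1) ^ (n * β + c * n.choose 2) * (n * c).factorial * h2 +
      (∏ j ∈ range n, ((β + j * c).choose (j * c) : ℤ)) * (c.factorial : ℤ) ^ n * h3 +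
      (-1) ^ n * (∏ j ∈ range n, ((b : ℤ) - β + j * c)) * ih

theorem morrisCoeff_base_eq (n b : ℕ) {c : ℕ} (hc : 1 ≤ c) :
    morrisCoeff n ((n - 1) * c) b c * (c.factorial : ℤ) ^ n =
      (-1) ^ (c * n.choose 2) * (n * c).factorial := by
  induction n generalizing b with
  | zero => simp [morrisCoeff_zero]
  | succ n ih =>
    rw [Nat.add_sub_cancel, morrisCoeff_base_succ]
    rcases n with _ | n
    · simp [morrisCoeff_zero]
    have h := morris_identity_of_base hc ih c (2 * c)
    have htel : ∀ m : ℕ, ∏ j ∈ range m, ((2 * c + j * c).choose c : ℤ) =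
        ((m + 1) * c).choose c * ∏ j ∈ range m, ((c + j * c).choose (j * c) : ℤ) := by
      intro m
      induction m with
      | zero => simp
      | succ m ihm =>
        rw [Finset.prod_range_succ, ihm, Finset.prod_range_succ, ← Nat.choose_symm_add,
          show 2 * c + m * c = (m + 1 + 1) * c by ring, show c + m * c = (m + 1) * c by ring]
        ring
    have hB : ∏ j ∈ range (n + 1), ((c + j * c).choose (j * c) : ℤ) ≠ 0 :=
      Finset.prod_ne_zero_iff.mpr fun j _ =>
        Nat.cast_ne_zero.mpr (Nat.choose_pos (Nat.le_add_left _ _)).ne'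
    rw [htel, show c + (n + 1 - 1) * c = (n + 1) * c by rw [Nat.add_sub_cancel]; ring] at h
    have hfac : ((n + 1 + 1) * c).choose c * c.factorial * ((n + 1) * c).factorial =
        ((n + 1 + 1) * c).factorial := by
      have := Nat.choose_mul_factorial_mul_factorial (n := (n + 1 + 1) * c) (k := c)
        (Nat.le_mul_of_pos_left _ (by omega))
      rwa [show (n + 1 + 1) * c - c = (n + 1) * c by rw [Nat.succ_mul, Nat.add_sub_cancel]] at this
    have hs : (-1 : ℤ) ^ (c * (n + 1 + 1).choose 2) =
        (-1) ^ ((n + 1) * c + c * (n + 1).choose 2) := by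
      rw [Nat.choose_succ_succ' (n + 1) 1, Nat.choose_one_right]
      congr 1; ring
    refine mul_right_cancel₀ hB ?_
    rw [hs, ← hfac]
    push_cast
    linear_combination (c.factorial : ℤ) * h

/-- The Morris constant term identity. -/
theorem morris_identity (n β b : ℕ) {c : ℕ} (hc : 1 ≤ c) :
    morrisCoeff n (β + (n - 1) * c) b c * (∏ j ∈ range n, ((β + j * c).choose (j * c) : ℤ)) *
        (c.factorial : ℤ) ^ n =
      (-1) ^ (n * β + c * n.choose 2) * (n * c).factorial *
        ∏ j ∈ range n, ((b + j * c).choose β : ℤ) :=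
  morris_identity_of_base hc (fun b => morrisCoeff_base_eq n b hc) β b

theorem selbergInt_eq_morrisCoeff {p n a : ℕ} (b c : ℕ) (ha : a ≤ p - 1) :
    selbergInt p n a b c = (morrisCoeff n (p - 1 - a) b c : ZMod p) := by
  have hX : (∏ i : Fin n, X i ^ a : MvPolynomial (Fin n) (ZMod p)) =
      monomial (constExp n a) 1 := by
    rw [monomial_eq, C_1, one_mul, Finsupp.prod_fintype _ _ (by simp)]
    simp
  have hmap : selbergPoly p n a b c = monomial (constExp n a) 1 *
      MvPolynomial.map (Int.castRingHom (ZMod p)) (morrisPoly n b c) := by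
    rw [← hX, selbergPoly, Finset.prod_mul_distrib, morrisPoly, vandermondePow]
    simp only [map_mul, map_prod, map_pow, map_sub, map_one, map_X]
    ring
  have he : (Finsupp.equivFunOnFinite.symm fun _ : Fin n => p - 1) =
      constExp n a + constExp n (p - 1 - a) := by
    ext i
    simp [constExp, ha]
  rw [selbergInt, hmap, he, coeff_monomial_mul, one_mul, coeff_map, morrisCoeff, eq_intCast]

theorem natCast_add_self_choose {p β : ℕ} [Fact p.Prime] (m : ℕ) (h : β < p) :
    ((m + p).choose β : ZMod p) = m.choose β := by
  have h1 : ∀ k : ℕ, (k.choose β : ZMod p) = (k % p).choose β := fun k => by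
    have := (ZMod.natCast_eq_natCast_iff _ _ p).mpr
      (Choose.choose_modEq_choose_mod_mul_choose_div_nat (n := k) (k := β) (p := p))
    simpa [Nat.mod_eq_of_lt h, Nat.div_eq_of_lt h] using this
  rw [h1 (m + p), h1 m, Nat.add_mod_right]

theorem natCast_choose_ne_zero {p m k : ℕ} [Fact p.Prime] (hm : m < p) (hk : k ≤ m) :
    (m.choose k : ZMod p) ≠ 0 := by
  rw [Ne, ZMod.natCast_eq_zero_iff]
  intro h
  have h2 : p ∣ m.factorial := by
    rw [← Nat.choose_mul_factorial_mul_factorial hk, mul_assoc]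
    exact h.mul_right _
  exact absurd (((Fact.out : p.Prime).dvd_factorial).mp h2) (by omega)

/-- The coefficient defining the Selberg integral vanishes if the Vandermonde factor has too
large a degree. -/
theorem selbergInt_eq_zero {p n : ℕ} (b c : ℕ) (hn : 1 ≤ n) (h : p - 1 < (n - 1) * c) :
    selbergInt p n 0 b c = 0 := by
  rw [selbergInt_eq_morrisCoeff b c (Nat.zero_le _), morrisCoeff, morrisPoly,
    coeff_mul_eq_zero_of_isHomogeneous (isHomogeneous_vandermondePow n c), Int.cast_zero]
  rw [degree_constExp]
  exact Nat.mul_lt_mul_of_pos_left (by omega) hn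

theorem choose_two_add (m i : ℕ) :
    (m + i).choose 2 = m.choose 2 + i.choose 2 + m * i := by
  induction i with
  | zero => simp
  | succ i ih =>
    rw [← add_assoc, Nat.choose_succ_succ' _ 1, ih, Nat.choose_succ_succ' i 1]
    simp
    ring

/-- The evaluation of the Selberg integral in `ZMod p`, for `β = p - 1 - (n-1)c - a`. -/
theorem selbergInt_mul {p n a β : ℕ} (b : ℕ) {c : ℕ} (hp : 1 ≤ p) (hc : 1 ≤ c)
    (h : β + (n - 1) * c + a = p - 1) :
    selbergInt p n a b c * (∏ j ∈ range n, ((β + j * c).choose (j * c) : ZMod p)) *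
        (c.factorial : ZMod p) ^ n =
      (-1) ^ (n * β + c * n.choose 2) * (n * c).factorial *
        ∏ j ∈ range n, ((b + j * c).choose β : ZMod p) := by
  rw [selbergInt_eq_morrisCoeff b c (by omega),
    show p - 1 - a = β + (n - 1) * c by omega]
  exact_mod_cast congrArg (Int.cast : ℤ → ZMod p) (morris_identity n β b hc)

/-- The factorization for `n = m + i` and `b = b' + p - m c`. -/
theorem selbergInt_add_mul {p m i a b b' c β : ℕ} [Fact p.Prime] (hc : 1 ≤ c) (hm : 1 ≤ m)
    (hi : 1 ≤ i) (h : β + (m + i - 1) * c + a = p - 1) (hb : b + m * c = b' + p) :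
    selbergInt p (m + i) a b c *
        (∏ j ∈ range (m + i), ((β + j * c).choose (j * c) : ZMod p)) =
      (-1) ^ (m * i * c) * (((m + i) * c).choose (i * c) : ZMod p) *
        ((∏ j ∈ range m, ((β + j * c).choose (j * c) : ZMod p)) *
          ∏ j ∈ range i, ((β + j * c).choose (j * c) : ZMod p)) *
        selbergInt p m (a + i * c) b c * selbergInt p i (a + m * c) b' c := by
  have hp : p.Prime := Fact.out
  have hp1 := hp.one_lt
  have e1 : (m + i - 1) * c = (m - 1) * c + i * c := by
    rw [← add_mul]; congr 1; omega
  have e2 : (m + i - 1) * c = (i - 1) * c + m * c := by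
    rw [← add_mul]; congr 1; omega
  have hcm : c ≤ m * c := Nat.le_mul_of_pos_left _ hm
  have h0 := selbergInt_mul b hp.one_le hc h
  have h1 := selbergInt_mul (n := m) (a := a + i * c) (β := β) b hp.one_le hc (by omega)
  have h2 := selbergInt_mul (n := i) (a := a + m * c) (β := β) b' hp.one_le hc (by omega)
  have hfac : (c.factorial : ZMod p) ^ (m + i) ≠ 0 := by
    refine pow_ne_zero _ ?_
    rw [Ne, ZMod.natCast_eq_zero_iff, hp.dvd_factorial]
    omega
  have hprod : ∏ j ∈ range (m + i), ((b + j * c).choose β : ZMod p) =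
      (∏ j ∈ range m, ((b + j * c).choose β : ZMod p)) *
        ∏ j ∈ range i, ((b' + j * c).choose β : ZMod p) := by
    rw [Finset.prod_range_add]
    congr 1
    refine Finset.prod_congr rfl fun j _ => ?_
    rw [← natCast_add_self_choose (b' + j * c) (by omega : β < p)]
    congr 2
    linear_combination hb
  have hchoose : (((m + i) * c).factorial : ZMod p) =
      ((m + i) * c).choose (i * c) * (i * c).factorial * (m * c).factorial := by
    have := Nat.choose_mul_factorial_mul_factorial (n := (m + i) * c) (k := i * c)
      (Nat.mul_le_mul_right _ (by omega))
    rw [show (m + i) * c - i * c = m * c by rw [add_mul, Nat.add_sub_cancel]] at this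
    rw [← this]
    push_cast
    rfl
  have hsign : (-1 : ZMod p) ^ ((m + i) * β + c * (m + i).choose 2) =
      (-1) ^ (m * i * c) * ((-1) ^ (m * β + c * m.choose 2) * (-1) ^ (i * β + c * i.choose 2)) := by
    rw [choose_two_add, ← pow_add, ← pow_add]
    congr 1
    ring
  refine mul_right_cancel₀ hfac ?_
  rw [h0, hprod, hchoose, hsign, pow_add]
  linear_combination -((-1) ^ (m * i * c) * (((m + i) * c).choose (i * c) : ZMod p)) *
    (congrArg₂ (· * ·) h1 h2 : _ * _ = _ * _)

/-- The factorization property of the `F_p`-Selberg integral. -/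
theorem Fp_selberg_factorization (p n a b c i : ℕ) [Fact p.Prime] (hodd : p ≠ 2)
    (hn : 1 ≤ n) (hc : 1 ≤ c) (hi1 : 1 ≤ i) (hin : i ≤ n - 1)
    (ha : a ≤ p - 1 - (n - 1) * c)
    (hb1 : p - 1 - (n - i) * c + 1 ≤ b) (hb2 : b ≤ p - 1 - (n - i - 1) * c) :
    selbergInt p n a b c =
      (-1) ^ ((n - i) * i * c) * (Nat.choose (n * c) (i * c) : ZMod p) *
        ((∏ j ∈ Finset.range (n - i),
            (Nat.choose (p - 1 - (n - (j + 1)) * c - a) (j * c) : ZMod p)) *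
          (∏ j ∈ Finset.range i,
            (Nat.choose (p - 1 - (n - (j + 1)) * c - a) (j * c) : ZMod p)) /
          ∏ j ∈ Finset.range n,
            (Nat.choose (p - 1 - (n - (j + 1)) * c - a) (j * c) : ZMod p)) *
        selbergInt p (n - i) (a + i * c) b c *
        selbergInt p i (a + (n - i) * c) (b + (n - i) * c - p) c := by
  rcases lt_or_ge (p - 1) ((n - 1) * c) with hlt | hle
  · obtain rfl : a = 0 := by omega
    have hzero : ∏ j ∈ Finset.range n,
        (Nat.choose (p - 1 - (n - (j + 1)) * c - 0) (j * c) : ZMod p) = 0 := by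
      refine Finset.prod_eq_zero (Finset.mem_range.mpr (by omega : n - 1 < n)) ?_
      rw [Nat.choose_eq_zero_of_lt (by omega), Nat.cast_zero]
    rw [selbergInt_eq_zero b c hn hlt, hzero]
    simp
  obtain ⟨m, rfl⟩ : ∃ m, n = m + i := ⟨n - i, by omega⟩
  rw [Nat.add_sub_cancel] at hb1 hb2 ⊢
  have hm : 1 ≤ m := by omega
  have hp := (Fact.out : p.Prime).one_lt
  obtain ⟨β, hβ⟩ : ∃ β, β + (m + i - 1) * c + a = p - 1 :=
    ⟨p - 1 - (m + i - 1) * c - a, by omega⟩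
  have hmc : m * c ≤ (m + i - 1) * c := Nat.mul_le_mul_right _ (by omega)
  have harg : ∀ j < m + i, p - 1 - (m + i - (j + 1)) * c - a = β + j * c := by
    intro j hj
    have : (m + i - 1) * c = (m + i - (j + 1)) * c + j * c := by
      rw [← add_mul]; congr 1; omega
    omega
  have hprod : ∀ k ≤ m + i, ∏ j ∈ Finset.range k,
      (Nat.choose (p - 1 - (m + i - (j + 1)) * c - a) (j * c) : ZMod p) =
        ∏ j ∈ Finset.range k, ((β + j * c).choose (j * c) : ZMod p) := fun k hk =>
    Finset.prod_congr rfl fun j hj => by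
      rw [harg j ((Finset.mem_range.mp hj).trans_le hk)]
  rw [hprod m (by omega), hprod i (by omega), hprod (m + i) le_rfl]
  have hne : ∏ j ∈ Finset.range (m + i), ((β + j * c).choose (j * c) : ZMod p) ≠ 0 := by
    refine Finset.prod_ne_zero_iff.mpr fun j hj => ?_
    refine natCast_choose_ne_zero ?_ (Nat.le_add_left _ _)
    rw [← harg j (Finset.mem_range.mp hj)]
    omega
  have key := selbergInt_add_mul (b := b) (b' := b + m * c - p) hc hm hi1 hβ (by omega)
  refine mul_right_cancel₀ hne ?_
  rw [key]
  field_simp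
end
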